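/- arXiv:2511.15234 — 3 statements merged into one kernel-verified Lean document; each statement's English description precedes it below -/
import Mathlib

section
/- (Weighted L∞–L∞ estimate for the 3D wave equation) Let w be a smooth solution of ∂_t²w − Δw = Ψ on (0,∞)×ℝ³, with Ψ continuous, and with zero initial data w(0,·)=∂_t w(0,·)=0, given by the Duhamel representation for the wave equation. Suppose ρ≥0, κ≥1, μ>0. Then there exists a constant C=C(ρ,κ,μ)>0 such that for all (t,x)∈(0,∞)×ℝ³: ⟨t+|x|⟩^{1−ρ} W_{κ−1}(t,|x|) |w(t,x)| ≤ C · sup{ |y| ⟨τ+|y|⟩^{κ+μ−ρ} W_−(τ,|y|)^{1−μ} |Ψ(τ,y)| : τ∈[0,t], y∈ℝ³, |y|−|x| ≤ t−τ }, and consequently also ⟨t+|x|⟩^{1−ρ} W_{κ−1}(t,|x|) |w(t,x)| ≤ C · sup{ ⟨τ+|y|⟩^{2+κ−ρ} |Ψ(τ,y)| : τ∈[0,t], y∈ℝ³ }. -/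
open MeasureTheory Real

noncomputable section

/-- Spacetime points: index `0` is time, indices `1,2,3` are space. -/
abbrev Pt : Type := Fin 4 → ℝ

/-- Spatial points in ℝ³. -/
abbrev Sp : Type := Fin 3 → ℝ

/-- Build a spacetime point from a time and a spatial point. -/
def pt (t : ℝ) (x : Sp) : Pt := Fin.cons t x

/-- Partial derivative ∂_i (i = 0 is ∂_t). -/
def pd (i : Fin 4) (u : Pt → ℝ) : Pt → ℝ := fun p => fderiv ℝ u p (Pi.single i 1)

/-- Euclidean norm of a spatial point. -/
def rnorm (x : Sp) : ℝ := Real.sqrt (∑ a, (x a) ^ 2)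

/-- Japanese bracket ⟨s⟩ = √(1+s²). -/
def jb (s : ℝ) : ℝ := Real.sqrt (1 + s ^ 2)

/-- Wave operator ∂_t² − Δ. -/
def box (u : Pt → ℝ) : Pt → ℝ := fun p =>
  pd 0 (pd 0 u) p - (pd 1 (pd 1 u) p + pd 2 (pd 2 u) p + pd 3 (pd 3 u) p)

/-- Rotation Ω_{ab} = x_a ∂_b − x_b ∂_a. -/
def Omg (a b : Fin 4) (u : Pt → ℝ) : Pt → ℝ := fun p => p a * pd b u p - p b * pd a u p

/-- Lorentz boost L_a = x_a ∂_t + t ∂_a. -/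
def Lb (a : Fin 4) (u : Pt → ℝ) : Pt → ℝ := fun p => p a * pd 0 u p + p 0 * pd a u p

/-- Scaling vector field S = t ∂_t + Σ x_a ∂_a. -/
def Sc (u : Pt → ℝ) : Pt → ℝ := fun p => ∑ i, p i * pd i u p

/-- The ten-field family V = {∂_α, Ω_{ab}, L_a}. -/
def VZ : Fin 10 → (Pt → ℝ) → Pt → ℝ :=
  ![pd 0, pd 1, pd 2, pd 3, Omg 1 2, Omg 1 3, Omg 2 3, Lb 1, Lb 2, Lb 3]

/-- The eleven-field family Γ = V ∪ {S}. -/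
def GZ : Fin 11 → (Pt → ℝ) → Pt → ℝ :=
  ![pd 0, pd 1, pd 2, pd 3, Omg 1 2, Omg 1 3, Omg 2 3, Lb 1, Lb 2, Lb 3, Sc]

/-- Composition Z^I of fields from V. -/
def compV (I : List (Fin 10)) (u : Pt → ℝ) : Pt → ℝ := I.foldr (fun i f => VZ i f) u

/-- Composition Γ^I of fields from V ∪ {S}. -/
def compG (I : List (Fin 11)) (u : Pt → ℝ) : Pt → ℝ := I.foldr (fun i f => GZ i f) u

/-- Null form Q₀(u,v) = −∂_t u ∂_t v + Σ_a ∂_a u ∂_a v. -/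
def Q0 (u v : Pt → ℝ) : Pt → ℝ := fun p =>
  -(pd 0 u p * pd 0 v p) + ∑ a : Fin 3, pd a.succ u p * pd a.succ v p

/-- Null form Q_{αβ}(u,v) = ∂_α u ∂_β v − ∂_β u ∂_α v. -/
def Qab (α β : Fin 4) (u v : Pt → ℝ) : Pt → ℝ := fun p =>
  pd α u p * pd β v p - pd β u p * pd α v p

/-- Good derivative G_a = (x_a/r) ∂_t + ∂_a. -/
def Ga (a : Fin 3) (u : Pt → ℝ) : Pt → ℝ := fun p =>
  (p a.succ / Real.sqrt ((p 1) ^ 2 + (p 2) ^ 2 + (p 3) ^ 2)) * pd 0 u p + pd a.succ u p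

/-- L² norm of a function on ℝ³. -/
def L2norm (g : Sp → ℝ) : ℝ := (∫ x : Sp, (g x) ^ 2) ^ (1/2 : ℝ)

/-- Spatial partial derivative on ℝ³. -/
def pd3 (a : Fin 3) (f : Sp → ℝ) : Sp → ℝ := fun x => fderiv ℝ f x (Pi.single a 1)

/-- Composition ∇^I of spatial partial derivatives. -/
def compD (I : List (Fin 3)) (f : Sp → ℝ) : Sp → ℝ := I.foldr (fun a g => pd3 a g) f

/-- Euclidean norm of the spatial gradient. -/
def gradNorm (f : Sp → ℝ) (x : Sp) : ℝ := Real.sqrt (∑ a, (pd3 a f x) ^ 2)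

/-- The weight W_ρ(t,r). -/
def Wfn (ρ : ℝ) (t r : ℝ) : ℝ :=
  if ρ < 0 then jb (t + r) ^ ρ
  else if ρ = 0 then (Real.log (2 + jb (t + r) * (jb (t - r))⁻¹))⁻¹
  else jb (t - r) ^ ρ

/-- The weight W_-(t,r) = min {⟨r⟩, ⟨t−r⟩}. -/
def Wm (t r : ℝ) : ℝ := min (jb r) (jb (t - r))

/-- Fubini for continuous integrands on rectangles. -/
lemma cont_swap (f : ℝ → ℝ → ℝ) (hf : Continuous (Function.uncurry f)) (a b c d : ℝ) :
    ∫ x in a..b, ∫ y in c..d, f x y = ∫ y in c..d, ∫ x in a..b, f x y := by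
  apply intervalIntegral_intervalIntegral_swap
  have h1 : IsCompact (Set.uIcc a b ×ˢ Set.uIcc c d) := isCompact_uIcc.prod isCompact_uIcc
  exact (hf.continuousOn.integrableOn_compact h1).mono_set
    (Set.prod_mono Set.uIoc_subset_uIcc Set.uIoc_subset_uIcc)

/-- Averaging an identity over the sphere parameters. -/
lemma avg_lemma (S A B : ℝ → ℝ → ℝ → ℝ) (W t : ℝ)
    (hS : Continuous (fun p : ℝ × ℝ × ℝ => S p.1 p.2.1 p.2.2))
    (hA : Continuous (fun p : ℝ × ℝ × ℝ => A p.1 p.2.1 p.2.2))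
    (hB : Continuous (fun p : ℝ × ℝ × ℝ => B p.1 p.2.1 p.2.2))
    (hA0 : ∀ τ φ, ∫ θ in (0:ℝ)..π, A τ θ φ = 0)
    (hB0 : ∀ τ θ, ∫ φ in (0:ℝ)..(2*π), B τ θ φ = 0)
    (hW : ∀ θ φ, ∫ τ in (0:ℝ)..t, (S τ θ φ + A τ θ φ + B τ θ φ) = sin θ * W) :
    4 * π * W = ∫ φ in (0:ℝ)..(2*π), ∫ τ in (0:ℝ)..t, ∫ θ in (0:ℝ)..π, S τ θ φ := by
  have c3 : ∀ (F : ℝ → ℝ → ℝ → ℝ), Continuous (fun p : ℝ × ℝ × ℝ => F p.1 p.2.1 p.2.2) →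
      ∀ θ φ, Continuous (fun τ => F τ θ φ) := fun F hF θ φ =>
    hF.comp (f := fun τ : ℝ => ((τ, θ, φ) : ℝ × ℝ × ℝ)) (by fun_prop)
  have cI : ∀ (F : ℝ → ℝ → ℝ → ℝ), Continuous (fun p : ℝ × ℝ × ℝ => F p.1 p.2.1 p.2.2) →
      Continuous (fun q : ℝ × ℝ => ∫ τ in (0:ℝ)..t, F τ q.1 q.2) := by
    intro F hF
    apply intervalIntegral.continuous_parametric_intervalIntegral_of_continuous'
      (f := fun (q : ℝ × ℝ) τ => F τ q.1 q.2)
    exact hF.comp (f := fun q : (ℝ × ℝ) × ℝ => ((q.2, q.1.1, q.1.2) : ℝ × ℝ × ℝ)) (by fun_prop)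
  have cII : ∀ (F : ℝ → ℝ → ℝ → ℝ), Continuous (fun p : ℝ × ℝ × ℝ => F p.1 p.2.1 p.2.2) →
      Continuous (fun φ : ℝ => ∫ θ in (0:ℝ)..π, ∫ τ in (0:ℝ)..t, F τ θ φ) := by
    intro F hF
    apply intervalIntegral.continuous_parametric_intervalIntegral_of_continuous'
      (f := fun (φ : ℝ) θ => ∫ τ in (0:ℝ)..t, F τ θ φ)
    exact (cI F hF).comp (f := fun q : ℝ × ℝ => ((q.2, q.1) : ℝ × ℝ)) (by fun_prop)
  have cI1 : ∀ (F : ℝ → ℝ → ℝ → ℝ), Continuous (fun p : ℝ × ℝ × ℝ => F p.1 p.2.1 p.2.2) →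
      ∀ φ, Continuous (fun θ : ℝ => ∫ τ in (0:ℝ)..t, F τ θ φ) := fun F hF φ =>
    (cI F hF).comp (f := fun θ : ℝ => ((θ, φ) : ℝ × ℝ)) (by fun_prop)
  have e1 : ∫ φ in (0:ℝ)..(2*π), ∫ θ in (0:ℝ)..π, ∫ τ in (0:ℝ)..t,
      (S τ θ φ + A τ θ φ + B τ θ φ) = 4 * π * W := by
    simp_rw [hW, intervalIntegral.integral_mul_const, integral_sin]
    rw [intervalIntegral.integral_const]
    simp only [cos_zero, cos_pi, smul_eq_mul]
    ring
  have e2 : ∀ φ, ∫ θ in (0:ℝ)..π, ∫ τ in (0:ℝ)..t, (S τ θ φ + A τ θ φ + B τ θ φ)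
      = (∫ θ in (0:ℝ)..π, ∫ τ in (0:ℝ)..t, S τ θ φ)
        + (∫ θ in (0:ℝ)..π, ∫ τ in (0:ℝ)..t, A τ θ φ)
        + (∫ θ in (0:ℝ)..π, ∫ τ in (0:ℝ)..t, B τ θ φ) := by
    intro φ
    rw [← intervalIntegral.integral_add, ← intervalIntegral.integral_add]
    · apply intervalIntegral.integral_congr
      intro θ _
      simp only
      rw [intervalIntegral.integral_add, intervalIntegral.integral_add]
      · exact (c3 S hS θ φ).intervalIntegrable _ _
      · exact (c3 A hA θ φ).intervalIntegrable _ _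
      · exact ((c3 S hS θ φ).add (c3 A hA θ φ)).intervalIntegrable _ _
      · exact (c3 B hB θ φ).intervalIntegrable _ _
    · exact ((cI1 S hS φ).add (cI1 A hA φ)).intervalIntegrable _ _
    · exact (cI1 B hB φ).intervalIntegrable _ _
    · exact (cI1 S hS φ).intervalIntegrable _ _
    · exact (cI1 A hA φ).intervalIntegrable _ _
  have sw : ∀ (F : ℝ → ℝ → ℝ → ℝ), Continuous (fun p : ℝ × ℝ × ℝ => F p.1 p.2.1 p.2.2) →
      ∀ φ, ∫ θ in (0:ℝ)..π, ∫ τ in (0:ℝ)..t, F τ θ φ = ∫ τ in (0:ℝ)..t, ∫ θ in (0:ℝ)..π, F τ θ φ := by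
    intro F hF φ
    exact cont_swap (fun θ τ => F τ θ φ)
      (hF.comp (f := fun q : ℝ × ℝ => ((q.2, q.1, φ) : ℝ × ℝ × ℝ)) (by fun_prop)) _ _ _ _
  have e3 : ∫ φ in (0:ℝ)..(2*π), ∫ θ in (0:ℝ)..π, ∫ τ in (0:ℝ)..t, B τ θ φ = 0 := by
    rw [cont_swap (fun φ θ => ∫ τ in (0:ℝ)..t, B τ θ φ)
      ((cI B hB).comp (f := fun q : ℝ × ℝ => ((q.2, q.1) : ℝ × ℝ)) (by fun_prop))]
    have : ∀ θ, ∫ φ in (0:ℝ)..(2*π), ∫ τ in (0:ℝ)..t, B τ θ φ = 0 := by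
      intro θ
      rw [cont_swap (fun φ τ => B τ θ φ)
        (hB.comp (f := fun q : ℝ × ℝ => ((q.2, θ, q.1) : ℝ × ℝ × ℝ)) (by fun_prop))]
      simp [hB0]
    simp [this]
  rw [← e1]
  simp_rw [e2]
  rw [intervalIntegral.integral_add, intervalIntegral.integral_add, e3]
  · simp_rw [sw S hS, sw A hA, hA0]
    simp
  · exact (cII S hS).intervalIntegrable _ _
  · exact (cII A hA).intervalIntegrable _ _
  · exact ((cII S hS).add (cII A hA)).intervalIntegrable _ _
  · exact (cII B hB).intervalIntegrable _ _

section Kirchhoff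

variable {V : Type*} [NormedAddCommGroup V] [NormedSpace ℝ V]

/-- unit sphere direction -/
def dirO (E1 E2 E3 : V) (θ φ : ℝ) : V := (sin θ * cos φ) • E1 + (sin θ * sin φ) • E2 + cos θ • E3

/-- polar direction -/
def dirT (E1 E2 E3 : V) (θ φ : ℝ) : V := (cos θ * cos φ) • E1 + (cos θ * sin φ) • E2 - sin θ • E3

/-- azimuthal direction -/
def dirF (E1 E2 : V) (φ : ℝ) : V := (-sin φ) • E1 + cos φ • E2

/-- point of the backward cone -/
def conePt (E0 E1 E2 E3 X : V) (t τ θ φ : ℝ) : V := τ • E0 + X + (t - τ) • dirO E1 E2 E3 θ φ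

/-- abstract wave operator -/
def absBox (w : V → ℝ) (E0 E1 E2 E3 : V) (p : V) : ℝ :=
  fderiv ℝ (fderiv ℝ w) p E0 E0 - (fderiv ℝ (fderiv ℝ w) p E1 E1 + fderiv ℝ (fderiv ℝ w) p E2 E2
    + fderiv ℝ (fderiv ℝ w) p E3 E3)

lemma hasDerivAt_dirO_theta (E1 E2 E3 : V) (θ φ : ℝ) :
    HasDerivAt (fun θ => dirO E1 E2 E3 θ φ) (dirT E1 E2 E3 θ φ) θ := by
  unfold dirO dirT
  have h := ((((hasDerivAt_sin θ).mul_const (cos φ)).smul_const E1).add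
    (((hasDerivAt_sin θ).mul_const (sin φ)).smul_const E2)).add ((hasDerivAt_cos θ).smul_const E3)
  refine h.congr_deriv ?_
  module

lemma hasDerivAt_dirT_theta (E1 E2 E3 : V) (θ φ : ℝ) :
    HasDerivAt (fun θ => dirT E1 E2 E3 θ φ) (-dirO E1 E2 E3 θ φ) θ := by
  unfold dirO dirT
  have h := ((((hasDerivAt_cos θ).mul_const (cos φ)).smul_const E1).add
    (((hasDerivAt_cos θ).mul_const (sin φ)).smul_const E2)).sub ((hasDerivAt_sin θ).smul_const E3)
  refine h.congr_deriv ?_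
  module

lemma hasDerivAt_dirO_phi (E1 E2 E3 : V) (θ φ : ℝ) :
    HasDerivAt (fun φ => dirO E1 E2 E3 θ φ) (sin θ • dirF E1 E2 φ) φ := by
  unfold dirO dirF
  have h := ((((hasDerivAt_cos φ).const_mul (sin θ)).smul_const E1).add
    (((hasDerivAt_sin φ).const_mul (sin θ)).smul_const E2)).add (hasDerivAt_const φ (cos θ • E3))
  refine h.congr_deriv ?_
  module

lemma hasDerivAt_dirF_phi (E1 E2 E3 : V) (θ φ : ℝ) :
    HasDerivAt (fun φ => dirF E1 E2 φ)
      (-(sin θ • dirO E1 E2 E3 θ φ + cos θ • dirT E1 E2 E3 θ φ)) φ := by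
  unfold dirO dirT dirF
  have h := ((hasDerivAt_sin φ).neg.smul_const E1).add ((hasDerivAt_cos φ).smul_const E2)
  refine h.congr_deriv ?_
  have : cos θ ^ 2 = 1 - sin θ ^ 2 := by rw [← sin_sq_add_cos_sq θ]; ring
  have e : ∀ a b : ℝ, -(sin θ • (a • E1 + b • E2 + cos θ • E3) + (0:ℝ) • E1) =
     -(sin θ • (a • E1 + b • E2 + cos θ • E3)) := by intros; simp
  match_scalars
  · linear_combination (cos φ) * this
  · linear_combination (sin φ) * this
  · ring

lemma trace_id (T : V →L[ℝ] V →L[ℝ] ℝ) (hT : ∀ u v, T u v = T v u) (E1 E2 E3 : V) (θ φ : ℝ) :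
    T (dirO E1 E2 E3 θ φ) (dirO E1 E2 E3 θ φ) + T (dirT E1 E2 E3 θ φ) (dirT E1 E2 E3 θ φ)
      + T (dirF E1 E2 φ) (dirF E1 E2 φ) = T E1 E1 + T E2 E2 + T E3 E3 := by
  unfold dirO dirT dirF
  simp only [map_add, map_sub, map_smul, _root_.add_apply,
    _root_.sub_apply, _root_.smul_apply, smul_eq_mul]
  rw [hT E2 E1, hT E3 E1, hT E3 E2]
  have h1 : cos θ ^ 2 = 1 - sin θ ^ 2 := by rw [← sin_sq_add_cos_sq θ]; ring
  have h2 : cos φ ^ 2 = 1 - sin φ ^ 2 := by rw [← sin_sq_add_cos_sq φ]; ring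
  ring_nf
  simp only [h1, h2]
  ring

lemma deriv_along (w : V → ℝ) (hw : ContDiff ℝ 2 w) (c v : ℝ → V) (c' v' : V) (s : ℝ)
    (hc : HasDerivAt c c' s) (hv : HasDerivAt v v' s) :
    HasDerivAt (fun s => fderiv ℝ w (c s) (v s))
      (fderiv ℝ (fderiv ℝ w) (c s) c' (v s) + fderiv ℝ w (c s) v') s := by
  have hD1 : ContDiff ℝ 1 (fderiv ℝ w) := hw.fderiv_right (by norm_num)
  have h1 : HasFDerivAt (fderiv ℝ w) (fderiv ℝ (fderiv ℝ w) (c s)) (c s) :=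
    (hD1.differentiable (by norm_num) (c s)).hasFDerivAt
  exact (h1.comp_hasDerivAt s hc).clm_apply hv

theorem kirchhoff (w : V → ℝ) (hw : ContDiff ℝ 2 w) (E0 E1 E2 E3 X : V) (t : ℝ)
    (h0 : ∀ θ φ, w (conePt E0 E1 E2 E3 X t 0 θ φ) = 0)
    (h1 : ∀ θ φ, fderiv ℝ w (conePt E0 E1 E2 E3 X t 0 θ φ) (E0 + dirO E1 E2 E3 θ φ) = 0) :
    4 * π * w (t • E0 + X) = ∫ φ in (0:ℝ)..(2*π), ∫ τ in (0:ℝ)..t, ∫ θ in (0:ℝ)..π,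
      (t - τ) * sin θ * absBox w E0 E1 E2 E3 (conePt E0 E1 E2 E3 X t τ θ φ) := by
  have hD1 : ContDiff ℝ 1 (fderiv ℝ w) := hw.fderiv_right (by norm_num)
  have hDc : Continuous (fderiv ℝ w) := hD1.continuous
  have hD2c : Continuous (fderiv ℝ (fderiv ℝ w)) := hD1.continuous_fderiv (by norm_num)
  have hdw : ∀ p, HasFDerivAt w (fderiv ℝ w p) p := fun p =>
    (hw.differentiable (by norm_num) p).hasFDerivAt
  have hsymm : ∀ p u v, fderiv ℝ (fderiv ℝ w) p u v = fderiv ℝ (fderiv ℝ w) p v u := fun p u v =>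
    (hw.contDiffAt (x := p)).isSymmSndFDerivAt (by simp) u v
  set P := conePt E0 E1 E2 E3 X t with hP
  set O := dirO E1 E2 E3 with hO
  set Θ := dirT E1 E2 E3 with hΘ
  set Φ := dirF E1 E2 with hΦ
  have cP : Continuous (fun p : ℝ × ℝ × ℝ => P p.1 p.2.1 p.2.2) := by
    simp only [hP, conePt, dirO]; fun_prop
  have cO : Continuous (fun p : ℝ × ℝ × ℝ => O p.2.1 p.2.2) := by
    simp only [hO, dirO]; fun_prop
  have cΘ : Continuous (fun p : ℝ × ℝ × ℝ => Θ p.2.1 p.2.2) := by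
    simp only [hΘ, dirT]; fun_prop
  have cΦ : Continuous (fun p : ℝ × ℝ × ℝ => Φ p.2.2) := by
    simp only [hΦ, dirF]; fun_prop
  set D2 := fderiv ℝ (fderiv ℝ w) with hD2
  set D := fderiv ℝ w with hD
  -- the theta total derivative
  let A : ℝ → ℝ → ℝ → ℝ := fun τ θ φ => cos θ * D (P τ θ φ) (Θ θ φ) +
    sin θ * ((t - τ) * D2 (P τ θ φ) (Θ θ φ) (Θ θ φ) - D (P τ θ φ) (O θ φ))
  let B : ℝ → ℝ → ℝ → ℝ := fun τ θ φ => (t - τ) * sin θ * D2 (P τ θ φ) (Φ φ) (Φ φ)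
    - D (P τ θ φ) (sin θ • O θ φ + cos θ • Θ θ φ)
  let S : ℝ → ℝ → ℝ → ℝ := fun τ θ φ => (t - τ) * sin θ * absBox w E0 E1 E2 E3 (P τ θ φ)
  have cD : Continuous (fun p : ℝ × ℝ × ℝ => D (P p.1 p.2.1 p.2.2)) := hDc.comp cP
  have cD2 : Continuous (fun p : ℝ × ℝ × ℝ => D2 (P p.1 p.2.1 p.2.2)) := hD2c.comp cP
  have ct : Continuous (fun p : ℝ × ℝ × ℝ => t - p.1) := by fun_prop
  have cs : Continuous (fun p : ℝ × ℝ × ℝ => sin p.2.1) := by fun_prop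
  have cc : Continuous (fun p : ℝ × ℝ × ℝ => cos p.2.1) := by fun_prop
  have cA : Continuous (fun p : ℝ × ℝ × ℝ => A p.1 p.2.1 p.2.2) := by
    exact (cc.mul (cD.clm_apply cΘ)).add
      (cs.mul ((ct.mul ((cD2.clm_apply cΘ).clm_apply cΘ)).sub (cD.clm_apply cO)))
  have cB : Continuous (fun p : ℝ × ℝ × ℝ => B p.1 p.2.1 p.2.2) := by
    exact ((ct.mul cs).mul ((cD2.clm_apply cΦ).clm_apply cΦ)).sub
      (cD.clm_apply ((cs.smul cO).add (cc.smul cΘ)))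
  have cS : Continuous (fun p : ℝ × ℝ × ℝ => S p.1 p.2.1 p.2.2) := by
    have h2 : ∀ v : V, Continuous (fun p : ℝ × ℝ × ℝ => D2 (P p.1 p.2.1 p.2.2) v v) := fun v =>
      (cD2.clm_apply continuous_const).clm_apply continuous_const
    exact (ct.mul cs).mul ((h2 E0).sub (((h2 E1).add (h2 E2)).add (h2 E3)))
  have dPθ : ∀ τ θ φ, HasDerivAt (fun θ => P τ θ φ) ((t - τ) • Θ θ φ) θ := by
    intro τ θ φ
    simp only [hP, conePt]
    exact ((hasDerivAt_dirO_theta E1 E2 E3 θ φ).const_smul (t - τ)).const_add _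
  have dPφ : ∀ τ θ φ, HasDerivAt (fun φ => P τ θ φ) ((t - τ) • sin θ • Φ φ) φ := by
    intro τ θ φ
    simp only [hP, conePt]
    exact ((hasDerivAt_dirO_phi E1 E2 E3 θ φ).const_smul (t - τ)).const_add _
  have dPτ : ∀ τ θ φ, HasDerivAt (fun τ => P τ θ φ) (E0 - O θ φ) τ := by
    intro τ θ φ
    simp only [hP, conePt]
    have := (((hasDerivAt_id τ).smul_const E0).add_const X).add
      (((hasDerivAt_id τ).const_sub t).smul_const (O θ φ))
    refine this.congr_deriv ?_
    module
  have hA0 : ∀ τ φ, ∫ θ in (0:ℝ)..π, A τ θ φ = 0 := by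
    intro τ φ
    have hd : ∀ θ ∈ Set.uIcc (0:ℝ) π,
        HasDerivAt (fun θ => sin θ * D (P τ θ φ) (Θ θ φ)) (A τ θ φ) θ := by
      intro θ _
      have := (hasDerivAt_sin θ).mul
        (deriv_along w hw _ _ _ _ θ (dPθ τ θ φ) (hasDerivAt_dirT_theta E1 E2 E3 θ φ))
      refine this.congr_deriv ?_
      simp only [A, hO, hΘ, map_smul, map_neg, _root_.smul_apply, smul_eq_mul]
      ring
    rw [intervalIntegral.integral_eq_sub_of_hasDerivAt hd]
    · simp
    · exact (cA.comp (f := fun θ : ℝ => ((τ, θ, φ) : ℝ × ℝ × ℝ))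
        (by fun_prop)).intervalIntegrable _ _
  have hB0 : ∀ τ θ, ∫ φ in (0:ℝ)..(2*π), B τ θ φ = 0 := by
    intro τ θ
    have hd : ∀ φ ∈ Set.uIcc (0:ℝ) (2*π),
        HasDerivAt (fun φ => D (P τ θ φ) (Φ φ)) (B τ θ φ) φ := by
      intro φ _
      have := (deriv_along w hw _ _ _ _ φ (dPφ τ θ φ) (hasDerivAt_dirF_phi E1 E2 E3 θ φ))
      refine this.congr_deriv ?_
      simp only [B, hO, hΘ, hΦ, map_smul, map_neg, _root_.smul_apply, smul_eq_mul]
      ring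
    rw [intervalIntegral.integral_eq_sub_of_hasDerivAt hd]
    · simp [hP, hΦ, conePt, dirO, dirF]
    · exact (cB.comp (f := fun φ : ℝ => ((τ, θ, φ) : ℝ × ℝ × ℝ))
        (by fun_prop)).intervalIntegrable _ _
  have hW : ∀ θ φ, ∫ τ in (0:ℝ)..t, (S τ θ φ + A τ θ φ + B τ θ φ) = sin θ * w (t • E0 + X) := by
    intro θ φ
    have hd : ∀ τ ∈ Set.uIcc (0:ℝ) t,
        HasDerivAt (fun τ => sin θ * (w (P τ θ φ) + (t - τ) * D (P τ θ φ) (E0 + O θ φ)))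
          (S τ θ φ + A τ θ φ + B τ θ φ) τ := by
      intro τ _
      have := (((hdw (P τ θ φ)).comp_hasDerivAt τ (dPτ τ θ φ)).add
        (((hasDerivAt_id τ).const_sub t).mul
        (deriv_along w hw _ _ _ _ τ (dPτ τ θ φ)
          (hasDerivAt_const τ (E0 + O θ φ))))).const_mul (sin θ)
      refine this.congr_deriv ?_
      have tr := trace_id (D2 (P τ θ φ)) (hsymm _) E1 E2 E3 θ φ
      have sy := hsymm (P τ θ φ) E0 (O θ φ)
      simp only [S, A, B, absBox, map_smul, map_neg, map_add, map_sub,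
        _root_.smul_apply, _root_.sub_apply, smul_eq_mul, map_zero,
        Function.comp, id] at tr sy ⊢
      rw [← tr, sy]
      ring
    rw [intervalIntegral.integral_eq_sub_of_hasDerivAt hd]
    · simp only [sub_self, zero_mul, add_zero]
      rw [h0, h1]
      simp [hP, conePt]
    · exact ((cS.add cA).add cB |>.comp (f := fun τ : ℝ => ((τ, θ, φ) : ℝ × ℝ × ℝ))
        (by fun_prop)).intervalIntegrable _ _
  exact avg_lemma S A B (w (t • E0 + X)) t cS cA cB hA0 hB0 hW

end Kirchhoff

lemma rnorm_nonneg (x : Sp) : 0 ≤ rnorm x := Real.sqrt_nonneg _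

lemma rnorm_sq (x : Sp) : rnorm x ^ 2 = ∑ a, x a ^ 2 :=
  Real.sq_sqrt (Finset.sum_nonneg fun _ _ => sq_nonneg _)

/-- An orthonormal frame whose last vector points towards `x`. -/
lemma exists_frame (x : Sp) : ∃ e : Fin 3 → Sp,
    (∀ i j, ∑ a, e i a * e j a = if i = j then 1 else 0) ∧ x = rnorm x • e 2 := by
  have key : ∀ v : EuclideanSpace ℝ (Fin 3), ‖v‖ = 1 →
      ∃ b : OrthonormalBasis (Fin 3) ℝ (EuclideanSpace ℝ (Fin 3)), b 2 = v := by
    intro v hv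
    have := Orthonormal.exists_orthonormalBasis_extension_of_card_eq (𝕜 := ℝ)
      (E := EuclideanSpace ℝ (Fin 3)) (ι := Fin 3) (by simp) (v := fun _ => v) (s := {2})
      (by
        constructor
        · intro i; simpa using hv
        · intro i j hij
          exact absurd (Subsingleton.elim i j) hij)
    obtain ⟨b, hb⟩ := this
    exact ⟨b, hb 2 rfl⟩
  have fin : ∀ b : OrthonormalBasis (Fin 3) ℝ (EuclideanSpace ℝ (Fin 3)),
      ∀ i j, ∑ a, (b i) a * (b j) a = if i = j then 1 else 0 := by
    intro b i j
    have := (orthonormal_iff_ite.1 b.orthonormal) i j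
    rw [← this, PiLp.inner_apply]
    apply Finset.sum_congr rfl
    intro a _
    simp [mul_comm]
  have hn : ‖WithLp.toLp 2 x‖ = rnorm x := by
    rw [EuclideanSpace.norm_eq]
    simp [rnorm]
  by_cases hx : rnorm x = 0
  · obtain ⟨b, hb⟩ := key (EuclideanSpace.single 0 1) (by simp)
    refine ⟨fun i a => b i a, fin b, ?_⟩
    have h0 : WithLp.toLp 2 x = 0 := by rw [← norm_eq_zero, hn, hx]
    have h1 : x = 0 := by
      funext a
      have := congrArg (fun v : EuclideanSpace ℝ (Fin 3) => v a) h0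
      simpa using this
    rw [hx, zero_smul, h1]
  · obtain ⟨b, hb⟩ := key ((rnorm x)⁻¹ • WithLp.toLp 2 x) (by
      rw [norm_smul, hn, Real.norm_eq_abs, abs_of_nonneg (inv_nonneg.2 (rnorm_nonneg x)),
        inv_mul_cancel₀ hx])
    refine ⟨fun i a => b i a, fin b, ?_⟩
    funext a
    simp only [Pi.smul_apply, hb, smul_eq_mul]
    simp [hx]

/-- Spatial embedding as a linear map. -/
def emb : Sp →ₗ[ℝ] Pt where
  toFun v := pt 0 v
  map_add' u v := by
    funext i; refine Fin.cases ?_ (fun j => ?_) i <;> simp [pt]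
  map_smul' c v := by
    funext i; refine Fin.cases ?_ (fun j => ?_) i <;> simp [pt]

lemma emb_single (i : Fin 3) : emb (Pi.single i 1) = Pi.single i.succ 1 := by
  funext j
  refine Fin.cases ?_ (fun k => ?_) j
  · simp [emb, pt]
  · simp [emb, pt, Pi.single_apply]

lemma pt_eq (t : ℝ) (x : Sp) : pt t x = t • (Pi.single 0 1 : Pt) + emb x := by
  funext j
  refine Fin.cases ?_ (fun k => ?_) j <;> simp [emb, pt]

lemma trace_inv (T : Pt →L[ℝ] Pt →L[ℝ] ℝ) (e : Fin 3 → Sp)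
    (he : ∀ i j, ∑ a, e i a * e j a = if i = j then 1 else 0) :
    ∑ k, T (emb (e k)) (emb (e k)) = ∑ i : Fin 3, T (Pi.single i.succ 1) (Pi.single i.succ 1) := by
  have hQ : (Matrix.of e) * (Matrix.of e).transpose = 1 := by
    ext i j
    rw [Matrix.mul_apply]
    simp [he, Matrix.one_apply]
  have hQ' := mul_eq_one_comm.1 hQ
  have he' : ∀ i j, ∑ k, e k i * e k j = if i = j then 1 else 0 := by
    intro i j
    have := congrFun (congrFun hQ' i) j
    rw [Matrix.mul_apply] at this
    simpa [Matrix.one_apply] using this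
  have hexp : ∀ k, emb (e k) = ∑ i : Fin 3, e k i • (Pi.single i.succ 1 : Pt) := by
    intro k
    have : e k = ∑ i, e k i • (Pi.single i 1 : Sp) := by
      funext a
      simp [Finset.sum_apply, Pi.single_apply]
    conv_lhs => rw [this]
    rw [map_sum]
    simp only [map_smul, emb_single]
  simp only [hexp, Fin.sum_univ_three]
  simp only [map_add, map_smul, _root_.add_apply, _root_.smul_apply, smul_eq_mul]
  have h := he'
  simp only [Fin.sum_univ_three] at h
  have h00 := h 0 0
  have h01 := h 0 1
  have h02 := h 0 2
  have h11 := h 1 1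
  have h12 := h 1 2
  have h22 := h 2 2
  simp at h00 h01 h02 h11 h12 h22
  generalize T (Pi.single (Fin.succ 0) 1) (Pi.single (Fin.succ 0) 1) = t00
  generalize T (Pi.single (Fin.succ 0) 1) (Pi.single (Fin.succ 1) 1) = t01
  generalize T (Pi.single (Fin.succ 0) 1) (Pi.single (Fin.succ 2) 1) = t02
  generalize T (Pi.single (Fin.succ 1) 1) (Pi.single (Fin.succ 0) 1) = t10
  generalize T (Pi.single (Fin.succ 1) 1) (Pi.single (Fin.succ 1) 1) = t11
  generalize T (Pi.single (Fin.succ 1) 1) (Pi.single (Fin.succ 2) 1) = t12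
  generalize T (Pi.single (Fin.succ 2) 1) (Pi.single (Fin.succ 0) 1) = t20
  generalize T (Pi.single (Fin.succ 2) 1) (Pi.single (Fin.succ 1) 1) = t21
  generalize T (Pi.single (Fin.succ 2) 1) (Pi.single (Fin.succ 2) 1) = t22
  linear_combination t00 * h00 + (t01 + t10) * h01 + (t02 + t20) * h02 + t11 * h11
    + (t12 + t21) * h12 + t22 * h22

lemma pd_pd (w : Pt → ℝ) (hw : ContDiff ℝ 2 w) (i : Fin 4) (p : Pt) :
    pd i (pd i w) p = fderiv ℝ (fderiv ℝ w) p (Pi.single i 1) (Pi.single i 1) := by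
  have hD1 : ContDiff ℝ 1 (fderiv ℝ w) := hw.fderiv_right (by norm_num)
  unfold pd
  rw [fderiv_clm_apply (hD1.differentiable (by norm_num) p) (differentiableAt_const _)]
  simp

lemma absBox_eq (w : Pt → ℝ) (hw : ContDiff ℝ 2 w) (e : Fin 3 → Sp)
    (he : ∀ i j, ∑ a, e i a * e j a = if i = j then 1 else 0) (p : Pt) :
    absBox w (Pi.single 0 1) (emb (e 0)) (emb (e 1)) (emb (e 2)) p = box w p := by
  unfold absBox box
  rw [pd_pd w hw, pd_pd w hw, pd_pd w hw, pd_pd w hw]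
  have := trace_inv (fderiv ℝ (fderiv ℝ w) p) e he
  simp only [Fin.sum_univ_three] at this
  rw [this]
  rfl

/-- Spatial direction. -/
def spDir (e : Fin 3 → Sp) (θ φ : ℝ) : Sp := dirO (e 0) (e 1) (e 2) θ φ

lemma emb_spDir (e : Fin 3 → Sp) (θ φ : ℝ) :
    dirO (emb (e 0)) (emb (e 1)) (emb (e 2)) θ φ = emb (spDir e θ φ) := by
  simp only [dirO, spDir, map_add, map_smul]

lemma rnorm_cone (e : Fin 3 → Sp) (he : ∀ i j, ∑ a, e i a * e j a = if i = j then 1 else 0)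
    (x : Sp) (hx : x = rnorm x • e 2) (s θ φ : ℝ) :
    rnorm (x + s • spDir e θ φ) = √(rnorm x ^ 2 + s ^ 2 + 2 * rnorm x * s * cos θ) := by
  unfold rnorm
  congr 1
  change ∑ a, ((x + s • spDir e θ φ) a) ^ 2 = rnorm x ^ 2 + s ^ 2 + 2 * rnorm x * s * cos θ
  set r := rnorm x
  rw [hx]
  simp only [spDir, dirO, Pi.add_apply, Pi.smul_apply, smul_eq_mul, Fin.sum_univ_three]
  simp only [Fin.sum_univ_three] at he
  have h00 := he 0 0
  have h01 := he 0 1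
  have h02 := he 0 2
  have h11 := he 1 1
  have h12 := he 1 2
  have h22 := he 2 2
  simp at h00 h01 h02 h11 h12 h22
  have p1 := sin_sq_add_cos_sq θ
  have p2 := sin_sq_add_cos_sq φ
  linear_combination (s * (sin θ * cos φ)) ^ 2 * h00 + (s * (sin θ * sin φ)) ^ 2 * h11 +
    (r + s * cos θ) ^ 2 * h22 + 2 * (s * (sin θ * cos φ)) * (s * (sin θ * sin φ)) * h01
    + 2 * (s * (sin θ * cos φ)) * (r + s * cos θ) * h02
    + 2 * (s * (sin θ * sin φ)) * (r + s * cos θ) * h12 + s ^ 2 * sin θ ^ 2 * p2 + s ^ 2 * p1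

/-- Kirchhoff's formula in the concrete setting. -/
lemma kirch_concrete (w : Pt → ℝ) (hw : ContDiff ℝ 2 w)
    (h0 : ∀ x : Sp, w (pt 0 x) = 0 ∧ pd 0 w (pt 0 x) = 0) (t : ℝ) (x : Sp) (e : Fin 3 → Sp)
    (he : ∀ i j, ∑ a, e i a * e j a = if i = j then 1 else 0) :
    4 * π * w (pt t x) = ∫ φ in (0:ℝ)..(2*π), ∫ τ in (0:ℝ)..t, ∫ θ in (0:ℝ)..π,
      (t - τ) * sin θ * box w (pt τ (x + (t - τ) • spDir e θ φ)) := by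
  have hc : ∀ τ θ φ, conePt (Pi.single 0 1) (emb (e 0)) (emb (e 1)) (emb (e 2)) (emb x) t τ θ φ
      = pt τ (x + (t - τ) • spDir e θ φ) := by
    intro τ θ φ
    rw [conePt, emb_spDir, pt_eq, map_add, map_smul, add_assoc]
  have hsp : ∀ (y v : Sp), fderiv ℝ w (pt 0 y) (emb v) = 0 := by
    intro y v
    have h1 : HasDerivAt (fun s : ℝ => pt 0 y + s • emb v) (emb v) 0 := by
      simpa using ((hasDerivAt_id (0:ℝ)).smul_const (emb v)).const_add (pt 0 y)
    have h2 : HasFDerivAt w (fderiv ℝ w (pt 0 y)) (pt 0 y + (0:ℝ) • emb v) := by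
      simpa using (hw.differentiable (by norm_num) (pt 0 y)).hasFDerivAt
    have h3 := h2.comp_hasDerivAt (0:ℝ) h1
    have h4 : (w ∘ fun s : ℝ => pt 0 y + s • emb v) = fun _ => (0:ℝ) := by
      funext s
      have : pt 0 y + s • emb v = pt 0 (y + s • v) := by
        rw [pt_eq, pt_eq, map_add, map_smul, add_assoc]
      simp only [Function.comp, this, (h0 _).1]
    rw [h4] at h3
    exact h3.unique (hasDerivAt_const _ _)
  have := kirchhoff w hw (Pi.single 0 1) (emb (e 0)) (emb (e 1)) (emb (e 2)) (emb x) t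
    (by intro θ φ; rw [hc]; exact (h0 _).1)
    (by
      intro θ φ
      rw [hc, emb_spDir, map_add, hsp, add_zero]
      exact (h0 _).2)
  rw [← pt_eq] at this
  simpa only [hc, absBox_eq w hw e he] using this

/-- Change of variables on the sphere. -/
lemma sphere_cov (h : ℝ → ℝ) (hh : Continuous h) (r s : ℝ) (hr : 0 < r) (hs : 0 < s) (hrs : r ≠ s) :
    IntervalIntegrable (fun θ => s * sin θ * (h (√(r ^ 2 + s ^ 2 + 2 * r * s * cos θ)) /
      √(r ^ 2 + s ^ 2 + 2 * r * s * cos θ))) volume 0 π ∧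
    ∫ θ in (0:ℝ)..π, s * sin θ * (h (√(r ^ 2 + s ^ 2 + 2 * r * s * cos θ)) /
      √(r ^ 2 + s ^ 2 + 2 * r * s * cos θ)) = (1 / r) * ∫ l in |r - s|..(r + s), h l := by
  have hpos : ∀ θ : ℝ, 0 < r ^ 2 + s ^ 2 + 2 * r * s * cos θ := by
    intro θ
    have h1 : 0 < (r - s) ^ 2 := by
      have : r - s ≠ 0 := sub_ne_zero.2 hrs
      positivity
    nlinarith [neg_one_le_cos θ, mul_pos hr hs]
  have hInt0 : IntervalIntegrable (fun θ => s * sin θ * (h (√(r ^ 2 + s ^ 2 + 2 * r * s * cos θ)) /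
      √(r ^ 2 + s ^ 2 + 2 * r * s * cos θ))) volume 0 π := by
    apply Continuous.intervalIntegrable
    refine Continuous.mul (by fun_prop) (Continuous.div (by fun_prop) (by fun_prop) ?_)
    intro θ
    exact (Real.sqrt_pos.2 (hpos θ)).ne'
  refine ⟨hInt0, ?_⟩
  have hd : ∀ θ ∈ Set.uIcc (0:ℝ) π, HasDerivAt
      (fun θ => -(1 / r) * ∫ l in (0:ℝ)..√(r ^ 2 + s ^ 2 + 2 * r * s * cos θ), h l)
      (s * sin θ * (h (√(r ^ 2 + s ^ 2 + 2 * r * s * cos θ)) /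
      √(r ^ 2 + s ^ 2 + 2 * r * s * cos θ))) θ := by
    intro θ _
    have h1 : HasDerivAt (fun θ => r ^ 2 + s ^ 2 + 2 * r * s * cos θ) (2 * r * s * (-sin θ)) θ :=
      ((hasDerivAt_cos θ).const_mul (2 * r * s)).const_add _
    have h2 := h1.sqrt (hpos θ).ne'
    have h3 := intervalIntegral.integral_hasDerivAt_right (hh.intervalIntegrable 0
      (√(r ^ 2 + s ^ 2 + 2 * r * s * cos θ))) (hh.stronglyMeasurableAtFilter _ _) hh.continuousAt
    have h4 := (h3.comp θ h2).const_mul (-(1 / r))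
    refine h4.congr_deriv ?_
    have := (Real.sqrt_pos.2 (hpos θ)).ne'
    field_simp
  rw [intervalIntegral.integral_eq_sub_of_hasDerivAt hd hInt0]
  have e1 : √(r ^ 2 + s ^ 2 + 2 * r * s * cos π) = |r - s| := by
    rw [cos_pi, ← Real.sqrt_sq_eq_abs]; congr 1; ring
  have e2 : √(r ^ 2 + s ^ 2 + 2 * r * s * cos 0) = r + s := by
    rw [cos_zero, ← Real.sqrt_sq (by positivity : 0 ≤ r + s)]; congr 1; ring
  have e3 := intervalIntegral.integral_interval_sub_left (hh.intervalIntegrable (μ := volume) 0 (r + s))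
    (hh.intervalIntegrable 0 |r - s|)
  rw [e1, e2, ← e3]
  ring

/-- Bound for the solution, away from the axis and on the axis. -/
lemma wave_bound (w Ψ : Pt → ℝ) (hw : ContDiff ℝ 2 w)
    (hbox : ∀ p : Pt, 0 < p 0 → box w p = Ψ p)
    (h0 : ∀ x : Sp, w (pt 0 x) = 0 ∧ pd 0 w (pt 0 x) = 0) (t : ℝ) (ht : 0 < t) (x : Sp)
    (h : ℝ → ℝ → ℝ) (hc : Continuous (Function.uncurry h)) (M : ℝ)
    (hM : ∀ (τ : ℝ) (y : Sp), 0 < τ → τ < t → rnorm y - rnorm x ≤ t - τ →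
      rnorm y * |Ψ (pt τ y)| ≤ M * h τ (rnorm y)) :
    (0 < rnorm x → 2 * |w (pt t x)| ≤
      ∫ τ in (0:ℝ)..t, (M / rnorm x) * ∫ l in |rnorm x - (t - τ)|..(rnorm x + (t - τ)), h τ l) ∧
    (rnorm x = 0 → |w (pt t x)| ≤ ∫ τ in (0:ℝ)..t, M * h τ (t - τ)) := by
  obtain ⟨e, he, hx⟩ := exists_frame x
  set r := rnorm x with hr
  have hr0 : 0 ≤ r := rnorm_nonneg x
  have K := kirch_concrete w hw h0 t x e he
  -- the general reduction
  have red : ∀ g : ℝ → ℝ, IntervalIntegrable g volume 0 t →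
      (∀ᵐ τ, τ ∈ Set.Ioc 0 t → ∀ φ, |∫ θ in (0:ℝ)..π,
        (t - τ) * sin θ * box w (pt τ (x + (t - τ) • spDir e θ φ))| ≤ g τ) →
      2 * |w (pt t x)| ≤ ∫ τ in (0:ℝ)..t, g τ := by
    intro g hg hb
    have h1 := intervalIntegral.norm_integral_le_of_norm_le_const (a := 0) (b := 2 * π)
      (f := fun φ => ∫ τ in (0:ℝ)..t, ∫ θ in (0:ℝ)..π,
        (t - τ) * sin θ * box w (pt τ (x + (t - τ) • spDir e θ φ))) (C := ∫ τ in (0:ℝ)..t, g τ) (by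
      intro φ _
      apply intervalIntegral.norm_integral_le_of_norm_le ht.le _ hg
      filter_upwards [hb] with τ hτ hτ'
      exact hτ hτ' φ)
    rw [← K, Real.norm_eq_abs, abs_mul, abs_of_pos (by positivity : (0:ℝ) < 4 * π), sub_zero,
      abs_of_pos (by positivity : (0:ℝ) < 2 * π)] at h1
    have := Real.pi_pos
    nlinarith
  -- pointwise bound
  have pw : ∀ τ θ φ, 0 < τ → τ < t →
      √(r ^ 2 + (t - τ) ^ 2 + 2 * r * (t - τ) * cos θ) *
        |box w (pt τ (x + (t - τ) • spDir e θ φ))| ≤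
      M * h τ (√(r ^ 2 + (t - τ) ^ 2 + 2 * r * (t - τ) * cos θ)) := by
    intro τ θ φ h1 h2
    have h3 := rnorm_cone e he x hx (t - τ) θ φ
    have h4 : √(r ^ 2 + (t - τ) ^ 2 + 2 * r * (t - τ) * cos θ) ≤ r + (t - τ) := by
      apply Real.sqrt_le_iff.2
      refine ⟨by linarith, ?_⟩
      nlinarith [cos_le_one θ, mul_nonneg hr0 (sub_nonneg.2 h2.le)]
    have h5 := hM τ (x + (t - τ) • spDir e θ φ) h1 h2 (by rw [h3]; linarith)
    rw [h3] at h5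
    rw [hbox _ (by simpa [pt] using h1)]
    exact h5
  refine ⟨fun hpos => ?_, fun hzero => ?_⟩
  · apply red
    · apply Continuous.intervalIntegrable
      apply Continuous.mul continuous_const
      have e : ∀ τ, ∫ l in |r - (t - τ)|..(r + (t - τ)), h τ l =
          (∫ l in (0:ℝ)..(r + (t - τ)), h τ l) - ∫ l in (0:ℝ)..|r - (t - τ)|, h τ l := by
        intro τ
        have hcτ : Continuous (h τ) := hc.comp (f := fun l : ℝ => (τ, l)) (by fun_prop)
        rw [intervalIntegral.integral_interval_sub_left (hcτ.intervalIntegrable _ _)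
          (hcτ.intervalIntegrable _ _)]
      simp_rw [e]
      exact (intervalIntegral.continuous_parametric_intervalIntegral_of_continuous hc
        (by fun_prop)).sub
        (intervalIntegral.continuous_parametric_intervalIntegral_of_continuous hc (by fun_prop))
    · have hae : ∀ᵐ τ : ℝ, τ ≠ t ∧ τ ≠ t - r := by
        have a1 : ∀ᵐ τ : ℝ, τ ≠ t := Measure.ae_ne volume t
        have a2 : ∀ᵐ τ : ℝ, τ ≠ t - r := Measure.ae_ne volume (t - r)
        filter_upwards [a1, a2] with τ h1 h2 using ⟨h1, h2⟩
      filter_upwards [hae] with τ hne hτ φ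
      have hlt : τ < t := lt_of_le_of_ne hτ.2 hne.1
      have hs : 0 < t - τ := by linarith
      have hrs : r ≠ t - τ := fun hh => hne.2 (by linarith)
      have hcτ : Continuous (h τ) := hc.comp (f := fun l : ℝ => (τ, l)) (by fun_prop)
      obtain ⟨i1, i2⟩ := sphere_cov (h τ) hcτ r (t - τ) hpos hs hrs
      have i3 : M / r * ∫ l in |r - (t - τ)|..(r + (t - τ)), h τ l =
        ∫ θ in (0:ℝ)..π, M * ((t - τ) * sin θ *
          (h τ (√(r ^ 2 + (t - τ) ^ 2 + 2 * r * (t - τ) * cos θ)) /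
          √(r ^ 2 + (t - τ) ^ 2 + 2 * r * (t - τ) * cos θ))) := by
        rw [intervalIntegral.integral_const_mul, i2]; ring
      rw [i3, ← Real.norm_eq_abs]
      apply intervalIntegral.norm_integral_le_of_norm_le pi_pos.le _ (i1.const_mul M)
      refine Filter.Eventually.of_forall fun θ hθ => ?_
      have hsin : 0 ≤ sin θ := sin_nonneg_of_nonneg_of_le_pi hθ.1.le hθ.2
      have hl : 0 < √(r ^ 2 + (t - τ) ^ 2 + 2 * r * (t - τ) * cos θ) := by
        apply Real.sqrt_pos.2
        have h1 : 0 < (r - (t - τ)) ^ 2 := by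
          have : r - (t - τ) ≠ 0 := sub_ne_zero.2 hrs
          positivity
        nlinarith [neg_one_le_cos θ, mul_pos hpos hs]
      have := pw τ θ φ hτ.1 hlt
      rw [Real.norm_eq_abs, abs_mul, abs_of_nonneg (mul_nonneg hs.le hsin)]
      have h7 : |box w (pt τ (x + (t - τ) • spDir e θ φ))| ≤
          M * h τ (√(r ^ 2 + (t - τ) ^ 2 + 2 * r * (t - τ) * cos θ)) /
          √(r ^ 2 + (t - τ) ^ 2 + 2 * r * (t - τ) * cos θ) := by
        rw [le_div_iff₀ hl]; linarith
      calc _ ≤ (t - τ) * sin θ * (M * h τ (√(r ^ 2 + (t - τ) ^ 2 + 2 * r * (t - τ) * cos θ)) /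
          √(r ^ 2 + (t - τ) ^ 2 + 2 * r * (t - τ) * cos θ)) :=
            mul_le_mul_of_nonneg_left h7 (mul_nonneg hs.le hsin)
        _ = _ := by ring
  · have hred := red (fun τ => 2 * (M * h τ (t - τ))) (by
      apply Continuous.intervalIntegrable
      have : Continuous fun τ : ℝ => h τ (t - τ) :=
        hc.comp (f := fun τ : ℝ => (τ, t - τ)) (by fun_prop)
      fun_prop) (by
      have a1 : ∀ᵐ τ : ℝ, τ ≠ t := Measure.ae_ne volume t
      filter_upwards [a1] with τ hne hτ φ
      have hlt : τ < t := lt_of_le_of_ne hτ.2 hne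
      have hs : 0 < t - τ := by linarith
      have i3 : 2 * (M * h τ (t - τ)) = ∫ θ in (0:ℝ)..π, sin θ * (M * h τ (t - τ)) := by
        rw [intervalIntegral.integral_mul_const, integral_sin, cos_zero, cos_pi]; ring
      rw [i3, ← Real.norm_eq_abs]
      apply intervalIntegral.norm_integral_le_of_norm_le pi_pos.le _
        (by apply Continuous.intervalIntegrable; fun_prop)
      refine Filter.Eventually.of_forall fun θ hθ => ?_
      have hsin : 0 ≤ sin θ := sin_nonneg_of_nonneg_of_le_pi hθ.1.le hθ.2
      have := pw τ θ φ hτ.1 hlt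
      rw [hzero] at this
      have e5 : √(0 ^ 2 + (t - τ) ^ 2 + 2 * 0 * (t - τ) * cos θ) = t - τ := by
        rw [show (0:ℝ) ^ 2 + (t - τ) ^ 2 + 2 * 0 * (t - τ) * cos θ = (t - τ) ^ 2 by ring,
          Real.sqrt_sq hs.le]
      rw [e5] at this
      rw [Real.norm_eq_abs, abs_mul, abs_of_nonneg (mul_nonneg hs.le hsin)]
      nlinarith)
    rw [intervalIntegral.integral_const_mul] at hred
    linarith

/-- Fubini on the backward cone in null coordinates. -/
lemma fubini_tri (k : ℝ → ℝ → ℝ) (hk : Continuous (Function.uncurry k)) (hk0 : ∀ a b, 0 ≤ k a b)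
    (q : ℝ → ℝ) (hq : Continuous q)
    (hkq : ∀ α, 0 ≤ α → ∫ τ in (0:ℝ)..α, k τ (α - τ) ≤ q α) (t r : ℝ) (ht : 0 < t) (hr : 0 < r) :
    ∫ τ in (0:ℝ)..t, ∫ l in |r - (t - τ)|..(r + (t - τ)), k τ l ≤ ∫ α in |t - r|..(t + r), q α := by
  set a := |t - r| with ha
  set b := t + r with hb
  have ha0 : 0 ≤ a := abs_nonneg _
  have hab : a ≤ b := by rw [ha, abs_le]; constructor <;> linarith
  let G : ℝ × ℝ → ℝ := fun p => k p.1 (p.2 - p.1)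
  have hG : Continuous G := hk.comp (f := fun p : ℝ × ℝ => (p.1, p.2 - p.1)) (by fun_prop)
  let D : Set (ℝ × ℝ) := {p | p.1 ≤ p.2}
  have hD : MeasurableSet D := measurableSet_le measurable_fst measurable_snd
  let F : ℝ → ℝ → ℝ := fun τ α => D.indicator G (τ, α)
  have hF0 : ∀ τ α, 0 ≤ F τ α := fun τ α => Set.indicator_nonneg (fun _ _ => hk0 _ _) _
  have hFI : IntegrableOn (Function.uncurry F) (Set.Ioc 0 t ×ˢ Set.Ioc a b) := by
    have h1 : IntegrableOn G (Set.Icc 0 t ×ˢ Set.Icc a b) :=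
      hG.continuousOn.integrableOn_compact (isCompact_Icc.prod isCompact_Icc)
    have h2 := h1.mono_set (Set.prod_mono Set.Ioc_subset_Icc_self Set.Ioc_subset_Icc_self)
    exact h2.indicator hD
  have hFI' : Integrable (Function.uncurry F)
      ((volume.restrict (Set.Ioc 0 t)).prod (volume.restrict (Set.Ioc a b))) := by
    rw [Measure.prod_restrict]; exact hFI
  have cτ : ∀ τ, Continuous (fun α => G (τ, α)) := fun τ => hG.comp (by fun_prop)
  have cα : ∀ α, Continuous (fun τ => G (τ, α)) := fun α => hG.comp (by fun_prop)
  have hFτ : ∀ τ c d, IntervalIntegrable (F τ) volume c d := by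
    intro τ c d
    have h1 : IntervalIntegrable (fun α => G (τ, α)) volume c d := (cτ τ).intervalIntegrable _ _
    have : F τ = (Set.Ici τ).indicator (fun α => G (τ, α)) := by
      funext α
      simp only [F, D, Set.indicator, Set.mem_ofPred_eq, Set.mem_Ici]
    rw [this]
    exact ⟨h1.1.indicator measurableSet_Ici, h1.2.indicator measurableSet_Ici⟩
  -- step 1
  have s1 : ∀ τ ∈ Set.Ioc 0 t, ∫ l in |r - (t - τ)|..(r + (t - τ)), k τ l ≤ ∫ α in a..b, F τ α := by
    intro τ hτ
    have e1 : ∫ l in |r - (t - τ)|..(r + (t - τ)), k τ l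
        = ∫ α in (τ + |r - (t - τ)|)..b, k τ (α - τ) := by
      rw [intervalIntegral.integral_comp_sub_right (fun l => k τ l) τ]
      rw [show τ + |r - (t - τ)| - τ = |r - (t - τ)| by ring, show b - τ = r + (t - τ) by rw [hb]; ring]
    have hle : τ + |r - (t - τ)| ≤ b := by
      have : |r - (t - τ)| ≤ r + (t - τ) := by
        rw [abs_le]; constructor <;> linarith [hτ.2]
      linarith
    have hge : a ≤ τ + |r - (t - τ)| := by
      rw [ha, abs_le]
      constructor
      · linarith [le_abs_self (r - (t - τ)), hτ.1]
      · linarith [neg_abs_le (r - (t - τ)), hτ.1]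
    have e2 : ∫ α in (τ + |r - (t - τ)|)..b, k τ (α - τ)
        = ∫ α in (τ + |r - (t - τ)|)..b, F τ α := by
      apply intervalIntegral.integral_congr
      intro α hα
      rw [Set.uIcc_of_le hle] at hα
      have : (τ, α) ∈ D := by
        change τ ≤ α
        linarith [hα.1, abs_nonneg (r - (t - τ))]
      simp only [F, Set.indicator_of_mem this, G]
    rw [e1, e2]
    exact intervalIntegral.integral_mono_interval hge hle le_rfl
      (Filter.Eventually.of_forall fun α => hF0 τ α) (hFτ τ a b)
  -- step 3
  have s3 : ∀ α ∈ Set.Ioc a b, ∫ τ in (0:ℝ)..t, F τ α ≤ q α := by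
    intro α hα
    have hα0 : 0 ≤ α := ha0.trans hα.1.le
    refine le_trans ?_ (hkq α hα0)
    have e1 : ∫ τ in (0:ℝ)..t, F τ α = ∫ τ in (0:ℝ)..(min t α), k τ (α - τ) := by
      rw [intervalIntegral.integral_of_le ht.le, intervalIntegral.integral_of_le (le_min ht.le hα0)]
      have : (fun τ => F τ α) = (Set.Iic α).indicator (fun τ => G (τ, α)) := by
        funext τ
        simp only [F, D, Set.indicator, Set.mem_ofPred_eq, Set.mem_Iic]
      rw [this, setIntegral_indicator measurableSet_Iic]
      congr 2
      ext τ
      simp only [Set.mem_inter_iff, Set.mem_Ioc, Set.mem_Iic, le_min_iff]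
      tauto
    rw [e1]
    exact intervalIntegral.integral_mono_interval le_rfl (le_min ht.le hα0) (min_le_right _ _)
      (Filter.Eventually.of_forall fun τ => hk0 _ _) ((cα α).intervalIntegrable _ _)
  calc ∫ τ in (0:ℝ)..t, ∫ l in |r - (t - τ)|..(r + (t - τ)), k τ l
      ≤ ∫ τ in (0:ℝ)..t, ∫ α in a..b, F τ α := by
        rw [intervalIntegral.integral_of_le ht.le, intervalIntegral.integral_of_le ht.le]
        apply integral_mono_of_nonneg
        · filter_upwards [ae_restrict_mem measurableSet_Ioc] with τ hτ
          apply intervalIntegral.integral_nonneg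
          · rw [abs_le]; constructor <;> linarith [hτ.2]
          · intro l _; exact hk0 _ _
        · have := hFI'.integral_prod_left
          refine this.congr (Filter.Eventually.of_forall fun τ => ?_)
          simp only [Function.uncurry]
          rw [intervalIntegral.integral_of_le hab]
        · filter_upwards [ae_restrict_mem measurableSet_Ioc] with τ hτ using s1 τ hτ
    _ = ∫ α in a..b, ∫ τ in (0:ℝ)..t, F τ α := by
        apply intervalIntegral_intervalIntegral_swap
        rw [Set.uIoc_of_le ht.le, Set.uIoc_of_le hab]
        exact hFI
    _ ≤ ∫ α in a..b, q α := by
        rw [intervalIntegral.integral_of_le hab, intervalIntegral.integral_of_le hab]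
        apply integral_mono_of_nonneg
        · filter_upwards with α
          apply intervalIntegral.integral_nonneg ht.le
          intro τ _; exact hF0 _ _
        · exact (hq.intervalIntegrable a b).1
        · filter_upwards [ae_restrict_mem measurableSet_Ioc] with α hα using s3 α hα

lemma jb_pos (s : ℝ) : 0 < jb s := Real.sqrt_pos.2 (by positivity)

lemma one_le_jb (s : ℝ) : 1 ≤ jb s := by
  unfold jb; rw [Real.one_le_sqrt]; nlinarith [sq_nonneg s]

lemma jb_sq (s : ℝ) : jb s ^ 2 = 1 + s ^ 2 := Real.sq_sqrt (by positivity)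

lemma abs_le_jb (s : ℝ) : |s| ≤ jb s := by
  unfold jb; apply Real.abs_le_sqrt; linarith

lemma jb_abs (s : ℝ) : jb |s| = jb s := by simp [jb]

lemma jb_neg (s : ℝ) : jb (-s) = jb s := by simp [jb]

lemma jb_mono {a b : ℝ} (ha : 0 ≤ a) (hab : a ≤ b) : jb a ≤ jb b := by
  unfold jb; apply Real.sqrt_le_sqrt; nlinarith

lemma jb_le (a : ℝ) (ha : 0 ≤ a) : jb a ≤ 1 + a := by
  unfold jb; rw [Real.sqrt_le_left (by linarith)]; nlinarith

lemma le_jb (a : ℝ) : 1 + a ≤ √2 * jb a := by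
  unfold jb; rw [← Real.sqrt_mul (by norm_num)]
  apply Real.le_sqrt_of_sq_le; nlinarith [sq_nonneg (1 - a)]

lemma jb_cont : Continuous jb := by unfold jb; fun_prop

lemma Wm_pos (t r : ℝ) : 0 < Wm t r := lt_min (jb_pos _) (jb_pos _)

lemma one_le_Wm (t r : ℝ) : 1 ≤ Wm t r := le_min (one_le_jb _) (one_le_jb _)

/-- kernel -/
def hker (ρ κ μ τ l : ℝ) : ℝ := jb (τ + l) ^ (ρ - κ - μ) * Wm τ l ^ (μ - 1)

lemma hker_cont (ρ κ μ : ℝ) : Continuous (Function.uncurry (hker ρ κ μ)) := by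
  have h1 : Continuous (fun p : ℝ × ℝ => jb (p.1 + p.2)) := jb_cont.comp (by fun_prop)
  have h2 : Continuous (fun p : ℝ × ℝ => Wm p.1 p.2) := by
    unfold Wm
    exact (jb_cont.comp (by fun_prop)).min (jb_cont.comp (by fun_prop))
  exact (h1.rpow_const fun p => Or.inl (jb_pos _).ne').mul
    (h2.rpow_const fun p => Or.inl (Wm_pos _ _).ne')

lemma hker_nonneg (ρ κ μ τ l : ℝ) : 0 ≤ hker ρ κ μ τ l :=
  mul_nonneg (Real.rpow_nonneg (jb_pos _).le _) (Real.rpow_nonneg (Wm_pos _ _).le _)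

lemma jb_rpow_cont (c : ℝ) : Continuous (fun s => jb s ^ c) :=
  jb_cont.rpow_const fun s => Or.inl (jb_pos s).ne'

/-- `∫₀ˢ ⟨σ⟩^{μ-1} ≤ ⟨s⟩^μ/μ` -/
lemma int_jb (μ : ℝ) (hμ : 0 < μ) (hμ1 : μ ≤ 1) (s : ℝ) (hs : 0 ≤ s) :
    ∫ σ in (0:ℝ)..s, jb σ ^ (μ - 1) ≤ jb s ^ μ / μ := by
  have hd : ∀ σ ∈ Set.uIcc 0 s, HasDerivAt (fun σ => σ * (1 + σ ^ 2) ^ ((μ - 1) / 2))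
      (1 * (1 + σ ^ 2) ^ ((μ - 1) / 2) +
        σ * ((2 * σ) * ((μ - 1) / 2) * (1 + σ ^ 2) ^ ((μ - 1) / 2 - 1))) σ := by
    intro σ _
    have h1 : HasDerivAt (fun σ : ℝ => 1 + σ ^ 2) (2 * σ) σ := by
      simpa using (hasDerivAt_pow 2 σ).const_add 1
    exact (hasDerivAt_id σ).mul (h1.rpow_const (Or.inl (by positivity)))
  have hjb : ∀ σ c : ℝ, jb σ ^ c = (1 + σ ^ 2) ^ (c / 2) := by
    intro σ c
    unfold jb
    rw [Real.sqrt_eq_rpow, ← Real.rpow_mul (by positivity)]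
    congr 1; ring
  have cc : ∀ c : ℝ, Continuous (fun σ : ℝ => (1 + σ ^ 2) ^ c) := fun c =>
    Continuous.rpow_const (by fun_prop) fun σ => Or.inl (by positivity)
  have hi : IntervalIntegrable (fun σ : ℝ => 1 * (1 + σ ^ 2) ^ ((μ - 1) / 2) +
        σ * ((2 * σ) * ((μ - 1) / 2) * (1 + σ ^ 2) ^ ((μ - 1) / 2 - 1))) volume 0 s := by
    apply Continuous.intervalIntegrable
    have := cc ((μ - 1) / 2)
    have := cc ((μ - 1) / 2 - 1)
    fun_prop
  have h2 := intervalIntegral.integral_eq_sub_of_hasDerivAt hd hi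
  have h3 : ∫ σ in (0:ℝ)..s, μ * jb σ ^ (μ - 1) ≤ ∫ σ in (0:ℝ)..s, (1 * (1 + σ ^ 2) ^ ((μ - 1) / 2) +
        σ * ((2 * σ) * ((μ - 1) / 2) * (1 + σ ^ 2) ^ ((μ - 1) / 2 - 1))) := by
    apply intervalIntegral.integral_mono_on hs _ hi
    · intro σ _
      rw [hjb]
      have hp : (0:ℝ) < 1 + σ ^ 2 := by positivity
      rw [Real.rpow_sub_one hp.ne']
      have hq : 0 < (1 + σ ^ 2) ^ ((μ - 1) / 2) := Real.rpow_pos_of_pos hp _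
      set Q := (1 + σ ^ 2) ^ ((μ - 1) / 2)
      have : 1 * Q + σ * (2 * σ * ((μ - 1) / 2) * (Q / (1 + σ ^ 2))) - μ * Q
          = (1 - μ) * Q / (1 + σ ^ 2) := by field_simp; ring
      have h5 : 0 ≤ (1 - μ) * Q / (1 + σ ^ 2) :=
        div_nonneg (mul_nonneg (by linarith) hq.le) hp.le
      linarith
    · exact (continuous_const.mul (jb_rpow_cont _)).intervalIntegrable _ _
  rw [h2, intervalIntegral.integral_const_mul, zero_mul, sub_zero, ← hjb] at h3
  rw [le_div_iff₀ hμ]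
  have h6 : s * jb s ^ (μ - 1) ≤ jb s ^ μ := by
    rw [Real.rpow_sub_one (jb_pos s).ne', mul_div_assoc', div_le_iff₀ (jb_pos s), mul_comm]
    exact mul_le_mul_of_nonneg_left ((le_abs_self s).trans (abs_le_jb s))
      (Real.rpow_nonneg (jb_pos s).le _)
  linarith

lemma int_Wm (μ : ℝ) (hμ : 0 < μ) (α : ℝ) (hα : 0 ≤ α) :
    ∫ τ in (0:ℝ)..α, Wm τ (α - τ) ^ (μ - 1) ≤ (1 + 2 / μ) * jb α ^ μ := by
  have cW : Continuous (fun τ => Wm τ (α - τ) ^ (μ - 1)) := by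
    refine Continuous.rpow_const ?_ fun τ => Or.inl (Wm_pos _ _).ne'
    unfold Wm
    exact (jb_cont.comp (by fun_prop)).min (jb_cont.comp (by fun_prop))
  have hp : 0 < jb α ^ μ := Real.rpow_pos_of_pos (jb_pos _) _
  by_cases h1 : μ ≤ 1
  · have c1 : Continuous (fun τ => jb (α - τ) ^ (μ - 1)) :=
      (jb_rpow_cont (μ - 1)).comp (f := fun τ => α - τ) (by fun_prop)
    have c2 : Continuous (fun τ => jb (2 * τ - α) ^ (μ - 1)) :=
      (jb_rpow_cont (μ - 1)).comp (f := fun τ => 2 * τ - α) (by fun_prop)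
    have h2 : ∫ τ in (0:ℝ)..α, Wm τ (α - τ) ^ (μ - 1) ≤
        ∫ τ in (0:ℝ)..α, (jb (α - τ) ^ (μ - 1) + jb (2 * τ - α) ^ (μ - 1)) := by
      apply intervalIntegral.integral_mono_on hα (cW.intervalIntegrable _ _)
        ((c1.add c2).intervalIntegrable _ _)
      intro τ _
      change _ ≤ jb (α - τ) ^ (μ - 1) + jb (2 * τ - α) ^ (μ - 1)
      unfold Wm
      rw [show τ - (α - τ) = 2 * τ - α by ring]
      have p1 := Real.rpow_nonneg (jb_pos (α - τ)).le (μ - 1)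
      have p2 := Real.rpow_nonneg (jb_pos (2 * τ - α)).le (μ - 1)
      rcases min_choice (jb (α - τ)) (jb (2 * τ - α)) with h | h <;> rw [h] <;> linarith
    rw [intervalIntegral.integral_add (c1.intervalIntegrable _ _) (c2.intervalIntegrable _ _)] at h2
    have e1 : ∫ τ in (0:ℝ)..α, jb (α - τ) ^ (μ - 1) = ∫ σ in (0:ℝ)..α, jb σ ^ (μ - 1) := by
      rw [intervalIntegral.integral_comp_sub_left (fun σ => jb σ ^ (μ - 1)) α]
      simp
    have e2 : ∫ τ in (0:ℝ)..α, jb (2 * τ - α) ^ (μ - 1) = ∫ σ in (0:ℝ)..α, jb σ ^ (μ - 1) := by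
      rw [intervalIntegral.integral_comp_mul_sub (fun σ => jb σ ^ (μ - 1)) (by norm_num : (2:ℝ) ≠ 0) α]
      rw [show 2 * (0:ℝ) - α = -α by ring, show 2 * α - α = α by ring]
      rw [← intervalIntegral.integral_add_adjacent_intervals (b := 0)
        ((jb_rpow_cont _).intervalIntegrable _ _) ((jb_rpow_cont _).intervalIntegrable _ _)]
      have : ∫ σ in (-α)..0, jb σ ^ (μ - 1) = ∫ σ in (0:ℝ)..α, jb σ ^ (μ - 1) := by
        have := intervalIntegral.integral_comp_neg (a := 0) (b := α) (fun σ => jb σ ^ (μ - 1))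
        rw [neg_zero] at this
        rw [← this]
        simp only [jb_neg]
      rw [this, smul_eq_mul]; ring
    rw [e1, e2] at h2
    have h3 := int_jb μ hμ h1 α hα
    have : (1 + 2 / μ) * jb α ^ μ = jb α ^ μ + 2 * (jb α ^ μ / μ) := by ring
    linarith
  · push Not at h1
    have h2 : ∫ τ in (0:ℝ)..α, Wm τ (α - τ) ^ (μ - 1) ≤ ∫ τ in (0:ℝ)..α, jb α ^ (μ - 1) := by
      apply intervalIntegral.integral_mono_on hα (cW.intervalIntegrable _ _)
        (continuous_const.intervalIntegrable _ _)
      intro τ hτ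
      apply Real.rpow_le_rpow (Wm_pos _ _).le _ (by linarith)
      exact (min_le_left _ _).trans (jb_mono (by linarith [hτ.2]) (by linarith [hτ.1]))
    rw [intervalIntegral.integral_const, smul_eq_mul, sub_zero] at h2
    have h6 : α * jb α ^ (μ - 1) ≤ jb α ^ μ := by
      rw [Real.rpow_sub_one (jb_pos α).ne', mul_div_assoc', div_le_iff₀ (jb_pos α), mul_comm]
      exact mul_le_mul_of_nonneg_left ((le_abs_self α).trans (abs_le_jb α)) hp.le
    have : 0 ≤ 2 / μ * jb α ^ μ := by positivity
    nlinarith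

lemma int_hker (ρ κ μ : ℝ) (hμ : 0 < μ) (α : ℝ) (hα : 0 ≤ α) :
    ∫ τ in (0:ℝ)..α, hker ρ κ μ τ (α - τ) ≤ (1 + 2 / μ) * jb α ^ (ρ - κ) := by
  unfold hker
  have : ∀ τ : ℝ, τ + (α - τ) = α := fun τ => by ring
  simp only [this]
  rw [intervalIntegral.integral_const_mul]
  have h1 := mul_le_mul_of_nonneg_left (int_Wm μ hμ α hα)
    (Real.rpow_nonneg (jb_pos α).le (ρ - κ - μ))
  refine h1.trans (le_of_eq ?_)
  rw [show ρ - κ = (ρ - κ - μ) + μ by ring, Real.rpow_add (jb_pos α)]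
  ring_nf

lemma rnorm_zero0 : rnorm (0 : Sp) = 0 := by simp [rnorm]

lemma Wfn_nonneg_case (κ t r : ℝ) (hκ : 1 ≤ κ) :
    0 < Wfn (κ - 1) t r ∧ Wfn (κ - 1) t r ≤ 2 * jb (t - r) ^ (κ - 1) := by
  have hX : 0 < jb (t + r) * (jb (t - r))⁻¹ := mul_pos (jb_pos _) (inv_pos.2 (jb_pos _))
  unfold Wfn
  rw [if_neg (by linarith)]
  split_ifs with h
  · rw [h, Real.rpow_zero]
    have h1 : Real.log 2 ≤ Real.log (2 + jb (t + r) * (jb (t - r))⁻¹) :=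
      Real.log_le_log (by norm_num) (by linarith)
    have h2 : (1:ℝ) / 2 < Real.log 2 := by have := Real.log_two_gt_d9; linarith
    constructor
    · exact inv_pos.2 (by linarith)
    · rw [inv_le_comm₀ (by linarith) (by norm_num)]
      linarith
  · have := Real.rpow_pos_of_pos (jb_pos (t - r)) (κ - 1)
    constructor <;> linarith

lemma outer_int (κ : ℝ) (hκ : 1 ≤ κ) : ∃ C : ℝ, 0 < C ∧ ∀ t r : ℝ, 0 < t → 0 < r →
    (∫ α in |t - r|..(t + r), jb α ^ (-κ)) * Wfn (κ - 1) t r ≤ C := by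
  have hs2 : (0:ℝ) < √2 := by positivity
  have hpt : ∀ α : ℝ, 0 ≤ α → jb α ^ (-κ) ≤ √2 ^ κ * (1 + α) ^ (-κ) := by
    intro α hα
    have h1 : (√2 * jb α) ^ (-κ) ≤ (1 + α) ^ (-κ) :=
      Real.rpow_le_rpow_of_nonpos (by linarith) (le_jb α) (by linarith)
    rw [Real.mul_rpow hs2.le (jb_pos α).le, Real.rpow_neg hs2.le] at h1
    have h2 : 0 < √2 ^ κ := Real.rpow_pos_of_pos hs2 _
    calc jb α ^ (-κ) = √2 ^ κ * ((√2 ^ κ)⁻¹ * jb α ^ (-κ)) := by field_simp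
      _ ≤ _ := mul_le_mul_of_nonneg_left h1 h2.le
  have hmain : ∀ t r : ℝ, 0 < t → 0 < r → ∫ α in |t - r|..(t + r), jb α ^ (-κ) ≤
      √2 ^ κ * ∫ α in |t - r|..(t + r), (1 + α) ^ (-κ) := by
    intro t r ht hr
    have hab : |t - r| ≤ t + r := by rw [abs_le]; constructor <;> linarith
    rw [← intervalIntegral.integral_const_mul]
    apply intervalIntegral.integral_mono_on hab ((jb_rpow_cont _).intervalIntegrable _ _)
    · apply ContinuousOn.intervalIntegrable
      apply ContinuousOn.mul continuousOn_const
      apply ContinuousOn.rpow_const (by fun_prop)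
      intro α hα
      rw [Set.uIcc_of_le hab] at hα
      left; have := hα.1; have := abs_nonneg (t - r); linarith
    · intro α hα
      exact hpt α ((abs_nonneg _).trans hα.1)
  have hshift : ∀ a b : ℝ, ∫ α in a..b, (1 + α) ^ (-κ) = ∫ y in (1 + a)..(1 + b), y ^ (-κ) :=
    fun a b => intervalIntegral.integral_comp_add_left (fun y : ℝ => y ^ (-κ)) 1
  have h2κ : 0 < √2 ^ κ := Real.rpow_pos_of_pos hs2 _
  rcases eq_or_lt_of_le hκ with hκ1 | hκ1
  · refine ⟨√2 ^ κ * 2, by positivity, ?_⟩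
    intro t r ht hr
    have hab : |t - r| ≤ t + r := by rw [abs_le]; constructor <;> linarith
    have ha := abs_nonneg (t - r)
    set X := jb (t + r) * (jb (t - r))⁻¹ with hX
    have hX0 : 0 < X := mul_pos (jb_pos _) (inv_pos.2 (jb_pos _))
    have hW : Wfn (κ - 1) t r = (Real.log (2 + X))⁻¹ := by
      unfold Wfn
      rw [if_neg (by linarith), if_pos (by linarith)]
    have hlog : 0 < Real.log (2 + X) := Real.log_pos (by linarith)
    have h1 := hmain t r ht hr
    rw [hshift] at h1
    have e1 : ∫ y in (1 + |t - r|)..(1 + (t + r)), y ^ (-κ) =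
        Real.log ((1 + (t + r)) / (1 + |t - r|)) := by
      rw [← integral_inv_of_pos (by linarith) (by linarith)]
      apply intervalIntegral.integral_congr
      intro y _
      simp only
      rw [← hκ1, Real.rpow_neg_one]
    rw [e1] at h1
    have h3 : Real.log ((1 + (t + r)) / (1 + |t - r|)) ≤ 2 * Real.log (2 + X) := by
      rw [show 2 * Real.log (2 + X) = Real.log ((2 + X) ^ 2) by rw [Real.log_pow]; norm_num]
      apply Real.log_le_log
      · apply div_pos <;> linarith
      · rw [div_le_iff₀ (by linarith)]
        have a1 := le_jb (t + r)
        have a2 := jb_le |t - r| ha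
        rw [jb_abs] at a2
        have a3 : jb (t + r) = X * jb (t - r) := by
          rw [hX, mul_assoc, inv_mul_cancel₀ (jb_pos _).ne', mul_one]
        have a4 : √2 ≤ 2 := by
          rw [Real.sqrt_le_left (by norm_num)]; norm_num
        have a5 : √2 * jb (t + r) ≤ 2 * (X * jb (t - r)) := by
          rw [a3]
          exact mul_le_mul_of_nonneg_right a4 (mul_nonneg hX0.le (jb_pos _).le)
        have a6 : 2 * (X * jb (t - r)) ≤ 2 * X * (1 + |t - r|) := by
          rw [← mul_assoc]
          exact mul_le_mul_of_nonneg_left a2 (by linarith)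
        have a7 : 2 * X * (1 + |t - r|) ≤ (2 + X) ^ 2 * (1 + |t - r|) := by
          apply mul_le_mul_of_nonneg_right _ (by linarith)
          nlinarith
        linarith
    rw [hW, ← div_eq_mul_inv, div_le_iff₀ hlog]
    calc _ ≤ _ := h1
      _ ≤ √2 ^ κ * (2 * Real.log (2 + X)) := mul_le_mul_of_nonneg_left h3 h2κ.le
      _ = _ := by ring
  · refine ⟨√2 ^ κ / (κ - 1), div_pos h2κ (by linarith), ?_⟩
    intro t r ht hr
    have hab : |t - r| ≤ t + r := by rw [abs_le]; constructor <;> linarith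
    have ha := abs_nonneg (t - r)
    have hW : Wfn (κ - 1) t r = jb (t - r) ^ (κ - 1) := by
      unfold Wfn
      rw [if_neg (by linarith), if_neg (by linarith)]
    have h1 := hmain t r ht hr
    rw [hshift] at h1
    have e1 : ∫ y in (1 + |t - r|)..(1 + (t + r)), y ^ (-κ) =
        ((1 + (t + r)) ^ (-κ + 1) - (1 + |t - r|) ^ (-κ + 1)) / (-κ + 1) := by
      apply integral_rpow
      right
      refine ⟨by linarith, ?_⟩
      rw [Set.uIcc_of_le (by linarith)]
      intro h
      linarith [h.1]
    have h3 : ∫ y in (1 + |t - r|)..(1 + (t + r)), y ^ (-κ) ≤ jb (t - r) ^ (1 - κ) / (κ - 1) := by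
      rw [e1]
      have a1 : 0 ≤ (1 + (t + r)) ^ (-κ + 1) := Real.rpow_nonneg (by linarith) _
      have a2 : (1 + |t - r|) ^ (-κ + 1) ≤ jb (t - r) ^ (1 - κ) := by
        rw [show -κ + 1 = 1 - κ by ring, ← jb_abs]
        exact Real.rpow_le_rpow_of_nonpos (jb_pos _) (jb_le _ ha) (by linarith)
      rw [show -κ + 1 = -(κ - 1) by ring] at *
      rw [div_neg, ← neg_div]
      apply div_le_div_of_nonneg_right _ (by linarith)
      linarith
    have hp := Real.rpow_pos_of_pos (jb_pos (t - r)) (κ - 1)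
    rw [hW]
    calc _ ≤ (√2 ^ κ * (jb (t - r) ^ (1 - κ) / (κ - 1))) * jb (t - r) ^ (κ - 1) :=
          mul_le_mul_of_nonneg_right (h1.trans (mul_le_mul_of_nonneg_left h3 h2κ.le)) hp.le
      _ = √2 ^ κ / (κ - 1) * (jb (t - r) ^ (1 - κ) * jb (t - r) ^ (κ - 1)) := by ring
      _ = √2 ^ κ / (κ - 1) := by
          rw [← Real.rpow_add (jb_pos _)]
          simp

lemma outer_bound (κ : ℝ) (hκ : 1 ≤ κ) : ∃ C : ℝ, 0 < C ∧ ∀ t r : ℝ, 0 < t → 0 < r →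
    (1 / r) * (∫ α in |t - r|..(t + r), jb α ^ (-κ)) * (jb (t + r) * Wfn (κ - 1) t r) ≤ C := by
  obtain ⟨C, hC, hb⟩ := outer_int κ hκ
  refine ⟨20 + 4 * C, by linarith, ?_⟩
  intro t r ht hr
  have hab : |t - r| ≤ t + r := by rw [abs_le]; constructor <;> linarith
  have ha := abs_nonneg (t - r)
  have hdiff : t + r - |t - r| ≤ 2 * r := by linarith [le_abs_self (t - r)]
  obtain ⟨w1, w2⟩ := Wfn_nonneg_case κ t r hκ
  have hI0 : 0 ≤ ∫ α in |t - r|..(t + r), jb α ^ (-κ) :=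
    intervalIntegral.integral_nonneg hab fun α _ => Real.rpow_nonneg (jb_pos α).le _
  have hja := jb_pos (t - r)
  have hjb := jb_pos (t + r)
  by_cases hcase : jb (t + r) ≤ 5 * jb (t - r)
  · have h1 : ∫ α in |t - r|..(t + r), jb α ^ (-κ) ≤ 2 * r * jb (t - r) ^ (-κ) := by
      have : ∫ α in |t - r|..(t + r), jb α ^ (-κ) ≤ ∫ α in |t - r|..(t + r), jb (t - r) ^ (-κ) := by
        apply intervalIntegral.integral_mono_on hab ((jb_rpow_cont _).intervalIntegrable _ _)
          (continuous_const.intervalIntegrable _ _)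
        intro α hα
        rw [← jb_abs (t - r)]
        exact Real.rpow_le_rpow_of_nonpos (jb_pos _) (jb_mono ha hα.1) (by linarith)
      rw [intervalIntegral.integral_const, smul_eq_mul] at this
      exact this.trans (mul_le_mul_of_nonneg_right hdiff (Real.rpow_nonneg hja.le _))
    have hp : jb (t - r) ^ (-κ) * (jb (t - r) * jb (t - r) ^ (κ - 1)) = 1 := by
      rw [Real.rpow_sub_one hja.ne', Real.rpow_neg hja.le]
      have := (Real.rpow_pos_of_pos hja κ).ne'
      field_simp
    have hp0 := Real.rpow_pos_of_pos hja (-κ)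
    have hp1 := Real.rpow_pos_of_pos hja (κ - 1)
    calc _ ≤ (1 / r) * (2 * r * jb (t - r) ^ (-κ)) *
          ((5 * jb (t - r)) * (2 * jb (t - r) ^ (κ - 1))) := by gcongr
      _ = 20 * (jb (t - r) ^ (-κ) * (jb (t - r) * jb (t - r) ^ (κ - 1))) := by field_simp; ring
      _ ≤ _ := by rw [hp]; linarith
  · push Not at hcase
    have h1 : jb (t + r) ≤ 4 * r := by
      have a1 := jb_le (t + r) (by linarith)
      have a2 := one_le_jb (t - r)
      have a3 := abs_le_jb (t - r)
      linarith
    calc _ = (jb (t + r) / r) * ((∫ α in |t - r|..(t + r), jb α ^ (-κ)) * Wfn (κ - 1) t r) := by ring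
      _ ≤ 4 * C := by
        apply mul_le_mul _ (hb t r ht hr) (mul_nonneg hI0 w1.le) (by norm_num)
        rw [div_le_iff₀ hr]; exact h1
      _ ≤ _ := by linarith

theorem first_part (ρ κ μ : ℝ) (hρ : 0 ≤ ρ) (hκ : 1 ≤ κ) (hμ : 0 < μ) :
    ∃ C : ℝ, 0 < C ∧ ∀ w Ψ : Pt → ℝ, ContDiff ℝ (⊤ : ℕ∞) w →
      (∀ p : Pt, 0 < p 0 → box w p = Ψ p) →
      (∀ x : Sp, w (pt 0 x) = 0 ∧ pd 0 w (pt 0 x) = 0) →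
      ∀ (t : ℝ), 0 < t → ∀ x : Sp,
        (∀ M : ℝ,
          (∀ (τ : ℝ) (y : Sp), 0 ≤ τ → τ ≤ t → rnorm y - rnorm x ≤ t - τ →
            rnorm y * jb (τ + rnorm y) ^ (κ + μ - ρ) * (Wm τ (rnorm y)) ^ (1 - μ) *
              |Ψ (pt τ y)| ≤ M) →
          jb (t + rnorm x) ^ (1 - ρ) * Wfn (κ - 1) t (rnorm x) * |w (pt t x)| ≤ C * M) := by
  obtain ⟨C, hC, hb⟩ := outer_bound κ hκ
  have hK : 0 < 1 + 2 / μ := by positivity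
  refine ⟨(1 + 2 / μ) * (C + 2), by positivity, ?_⟩
  intro w Ψ hw hbox h0 t ht x M hM
  have hM0 : 0 ≤ M := by
    have := hM 0 0 le_rfl ht.le (by rw [rnorm_zero0]; linarith [rnorm_nonneg x])
    simpa [rnorm_zero0] using this
  have hw2 : ContDiff ℝ 2 w := contDiff_infty.1 hw 2
  obtain ⟨b1, b2⟩ := wave_bound w Ψ hw2 hbox h0 t ht x (hker ρ κ μ) (hker_cont ρ κ μ) M (by
    intro τ y h1 h2 h3
    have h4 := hM τ y h1.le h2.le h3
    have h5 := mul_le_mul_of_nonneg_right h4 (hker_nonneg ρ κ μ τ (rnorm y))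
    refine le_trans (le_of_eq ?_) h5
    unfold hker
    have hJ := jb_pos (τ + rnorm y)
    have hWm := Wm_pos τ (rnorm y)
    have e1 : jb (τ + rnorm y) ^ (κ + μ - ρ) * jb (τ + rnorm y) ^ (ρ - κ - μ) = 1 := by
      rw [← Real.rpow_add hJ]; ring_nf; simp
    have e2 : Wm τ (rnorm y) ^ (1 - μ) * Wm τ (rnorm y) ^ (μ - 1) = 1 := by
      rw [← Real.rpow_add hWm]; ring_nf; simp
    calc rnorm y * |Ψ (pt τ y)| = rnorm y * |Ψ (pt τ y)| *
          (jb (τ + rnorm y) ^ (κ + μ - ρ) * jb (τ + rnorm y) ^ (ρ - κ - μ)) *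
          (Wm τ (rnorm y) ^ (1 - μ) * Wm τ (rnorm y) ^ (μ - 1)) := by rw [e1, e2]; ring
      _ = _ := by ring)
  have hr0 := rnorm_nonneg x
  set r := rnorm x with hr
  obtain ⟨w1, w2⟩ := Wfn_nonneg_case κ t r hκ
  have hJ := jb_pos (t + r)
  have hJρ := Real.rpow_pos_of_pos hJ (1 - ρ)
  rcases eq_or_lt_of_le hr0 with hz | hpos
  · have h1 := b2 hz.symm
    rw [intervalIntegral.integral_const_mul] at h1
    have h2 := h1.trans (mul_le_mul_of_nonneg_left (int_hker ρ κ μ hμ t ht.le) hM0)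
    rw [← hz] at w1 w2 hJρ ⊢
    rw [add_zero, sub_zero] at *
    have hJt := jb_pos t
    have e1 : jb t ^ (1 - ρ) * jb t ^ (κ - 1) * jb t ^ (ρ - κ) = 1 := by
      rw [← Real.rpow_add hJt, ← Real.rpow_add hJt]; ring_nf; simp
    have hpk := Real.rpow_pos_of_pos hJt (κ - 1)
    have hpr := Real.rpow_pos_of_pos hJt (ρ - κ)
    calc _ ≤ jb t ^ (1 - ρ) * (2 * jb t ^ (κ - 1)) * (M * ((1 + 2 / μ) * jb t ^ (ρ - κ))) := by
          gcongr
      _ = 2 * M * (1 + 2 / μ) * (jb t ^ (1 - ρ) * jb t ^ (κ - 1) * jb t ^ (ρ - κ)) := by ring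
      _ = (1 + 2 / μ) * 2 * M := by rw [e1]; ring
      _ ≤ _ := by gcongr; linarith
  · have h1 := b1 hpos
    rw [intervalIntegral.integral_const_mul] at h1
    have hab : |t - r| ≤ t + r := by rw [abs_le]; constructor <;> linarith
    have h2 := fubini_tri (hker ρ κ μ) (hker_cont ρ κ μ) (hker_nonneg ρ κ μ)
      (fun α => (1 + 2 / μ) * jb α ^ (ρ - κ)) (continuous_const.mul (jb_rpow_cont _))
      (fun α hα => int_hker ρ κ μ hμ α hα) t r ht hpos
    rw [intervalIntegral.integral_const_mul] at h2
    have h3 : ∫ α in |t - r|..(t + r), jb α ^ (ρ - κ) ≤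
        jb (t + r) ^ ρ * ∫ α in |t - r|..(t + r), jb α ^ (-κ) := by
      rw [← intervalIntegral.integral_const_mul]
      apply intervalIntegral.integral_mono_on hab ((jb_rpow_cont _).intervalIntegrable _ _)
        ((continuous_const.mul (jb_rpow_cont _)).intervalIntegrable _ _)
      intro α hα
      have hα0 := (abs_nonneg _).trans hα.1
      change _ ≤ jb (t + r) ^ ρ * jb α ^ (-κ)
      rw [show ρ - κ = ρ + -κ by ring, Real.rpow_add (jb_pos α)]
      exact mul_le_mul_of_nonneg_right
        (Real.rpow_le_rpow (jb_pos α).le (jb_mono hα0 hα.2) hρ) (Real.rpow_nonneg (jb_pos α).le _)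
    have hI0 : 0 ≤ ∫ α in |t - r|..(t + r), jb α ^ (-κ) :=
      intervalIntegral.integral_nonneg hab fun α _ => Real.rpow_nonneg (jb_pos α).le _
    have h4 := hb t r ht hpos
    set I := ∫ α in |t - r|..(t + r), jb α ^ (-κ)
    have h5 : 2 * |w (pt t x)| ≤ M / r * ((1 + 2 / μ) * (jb (t + r) ^ ρ * I)) :=
      h1.trans (mul_le_mul_of_nonneg_left (h2.trans (mul_le_mul_of_nonneg_left h3 hK.le))
        (div_nonneg hM0 hr0))
    have e1 : jb (t + r) ^ (1 - ρ) * jb (t + r) ^ ρ = jb (t + r) := by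
      rw [← Real.rpow_add hJ]; ring_nf; simp
    have h6 : |w (pt t x)| ≤ M / r * ((1 + 2 / μ) * (jb (t + r) ^ ρ * I)) := by
      linarith [abs_nonneg (w (pt t x))]
    calc _ ≤ jb (t + r) ^ (1 - ρ) * Wfn (κ - 1) t r *
          (M / r * ((1 + 2 / μ) * (jb (t + r) ^ ρ * I))) := by gcongr
      _ = M * (1 + 2 / μ) * ((1 / r) * I *
          ((jb (t + r) ^ (1 - ρ) * jb (t + r) ^ ρ) * Wfn (κ - 1) t r)) := by ring
      _ = M * (1 + 2 / μ) * ((1 / r) * I * (jb (t + r) * Wfn (κ - 1) t r)) := by rw [e1]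
      _ ≤ M * (1 + 2 / μ) * C := by gcongr
      _ = (1 + 2 / μ) * C * M := by ring
      _ ≤ _ := by gcongr; linarith

/-- weighted L∞–L∞ estimate for the 3D wave equation with zero data.
The bound by the supremum is expressed by: for every upper bound M of the relevant set,
the left-hand side is at most C·M. -/
theorem stmt_14 (ρ κ μ : ℝ) (hρ : 0 ≤ ρ) (hκ : 1 ≤ κ) (hμ : 0 < μ) :
    ∃ C : ℝ, 0 < C ∧ ∀ w Ψ : Pt → ℝ, ContDiff ℝ (⊤ : ℕ∞) w → Continuous Ψ →
      (∀ p : Pt, 0 < p 0 → box w p = Ψ p) →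
      (∀ x : Sp, w (pt 0 x) = 0 ∧ pd 0 w (pt 0 x) = 0) →
      ∀ (t : ℝ), 0 < t → ∀ x : Sp,
        (∀ M : ℝ,
          (∀ (τ : ℝ) (y : Sp), 0 ≤ τ → τ ≤ t → rnorm y - rnorm x ≤ t - τ →
            rnorm y * jb (τ + rnorm y) ^ (κ + μ - ρ) * (Wm τ (rnorm y)) ^ (1 - μ) *
              |Ψ (pt τ y)| ≤ M) →
          jb (t + rnorm x) ^ (1 - ρ) * Wfn (κ - 1) t (rnorm x) * |w (pt t x)| ≤ C * M) ∧
        (∀ M : ℝ,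
          (∀ (τ : ℝ) (y : Sp), 0 ≤ τ → τ ≤ t →
            jb (τ + rnorm y) ^ (2 + κ - ρ) * |Ψ (pt τ y)| ≤ M) →
          jb (t + rnorm x) ^ (1 - ρ) * Wfn (κ - 1) t (rnorm x) * |w (pt t x)| ≤ C * M) := by
  obtain ⟨C1, hC1, h1⟩ := first_part ρ κ μ hρ hκ hμ
  obtain ⟨C2, hC2, h2⟩ := first_part ρ κ 1 hρ hκ one_pos
  refine ⟨C1 + C2, by linarith, ?_⟩
  intro w Ψ hw _ hbox h0 t ht x
  refine ⟨fun M hM => ?_, fun M hM => ?_⟩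
  · have hM0 : 0 ≤ M := by
      have := hM 0 0 le_rfl ht.le (by rw [rnorm_zero0]; linarith [rnorm_nonneg x])
      simpa [rnorm_zero0] using this
    have := h1 w Ψ hw hbox h0 t ht x M hM
    nlinarith
  · have hM0 : 0 ≤ M := le_trans
      (mul_nonneg (Real.rpow_nonneg (jb_pos _).le _) (abs_nonneg _)) (hM 0 0 le_rfl ht.le)
    have := h2 w Ψ hw hbox h0 t ht x M (by
      intro τ y hτ hτt _
      refine le_trans ?_ (hM τ y hτ hτt)
      rw [sub_self, Real.rpow_zero, mul_one]
      apply mul_le_mul_of_nonneg_right _ (abs_nonneg _)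
      have hJ := jb_pos (τ + rnorm y)
      rw [show 2 + κ - ρ = 1 + (κ + 1 - ρ) by ring, Real.rpow_add hJ, Real.rpow_one]
      apply mul_le_mul_of_nonneg_right _ (Real.rpow_nonneg hJ.le _)
      have h3 := abs_le_jb (τ + rnorm y)
      have h4 := le_abs_self (τ + rnorm y)
      linarith)
    nlinarith
end
end

section
/- (Conformal energy estimate for the 3D wave equation) Let w:[0,∞)×ℝ³→ℝ be smooth, with w(t,·) compactly supported in x uniformly for t in compact intervals, and suppose ∂_t²w − Δw = Ψ. Define the conformal energy 𝓕(t,w) = ∫_{ℝ³} ( |w|² + Σ_{1≤a<b≤3} |Ω_{ab}w|² + Σ_{a=1}³ |L_a w|² + |Sw|² )(t,x) dx. Then there is a universal constant C>0 such that for all t≥0: 𝓕^{1/2}(t,w) ≤ C ( 𝓕^{1/2}(0,w) + ∫₀^t ‖ ⟨τ+r⟩ Ψ(τ,·) ‖_{L²(ℝ³)} dτ ). -/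
open MeasureTheory Real

noncomputable section

/-- Conformal energy of w at time t. -/
def Fen (w : Pt → ℝ) (t : ℝ) : ℝ :=
  ∫ x : Sp, ((w (pt t x)) ^ 2 +
    ((Omg 1 2 w (pt t x)) ^ 2 + (Omg 1 3 w (pt t x)) ^ 2 + (Omg 2 3 w (pt t x)) ^ 2) +
    ((Lb 1 w (pt t x)) ^ 2 + (Lb 2 w (pt t x)) ^ 2 + (Lb 3 w (pt t x)) ^ 2) +
    (Sc w (pt t x)) ^ 2)


lemma pd_add' (j : Fin 4) {f g : Pt → ℝ} (hf : Differentiable ℝ f) (hg : Differentiable ℝ g)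
    (p : Pt) : pd j (fun p => f p + g p) p = pd j f p + pd j g p := by
  unfold pd
  rw [fderiv_fun_add (hf p) (hg p)]; rfl

lemma pd_sub' (j : Fin 4) {f g : Pt → ℝ} (hf : Differentiable ℝ f) (hg : Differentiable ℝ g)
    (p : Pt) : pd j (fun p => f p - g p) p = pd j f p - pd j g p := by
  unfold pd
  rw [fderiv_fun_sub (hf p) (hg p)]; rfl

lemma pd_mul' (j : Fin 4) {f g : Pt → ℝ} (hf : Differentiable ℝ f) (hg : Differentiable ℝ g)
    (p : Pt) : pd j (fun p => f p * g p) p = f p * pd j g p + g p * pd j f p := by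
  unfold pd
  rw [fderiv_fun_mul (hf p) (hg p)]; simp

lemma pd_const' (j : Fin 4) (c : ℝ) (p : Pt) : pd j (fun _ => c) p = 0 := by
  unfold pd; simp

lemma pd_coord (j i : Fin 4) (p : Pt) : pd j (fun p => p i) p = if i = j then 1 else 0 := by
  unfold pd
  have : HasFDerivAt (fun p : Pt => p i) (ContinuousLinearMap.proj (R := ℝ) i) p :=
    hasFDerivAt_apply i p
  rw [this.fderiv]; simp [Pi.single_apply]

/-- The positive conformal density. -/
def qd (w : Pt → ℝ) : Pt → ℝ := fun p =>
  (Sc w p + 2 * w p) ^ 2 + ((Omg 1 2 w p) ^ 2 + (Omg 1 3 w p) ^ 2 + (Omg 2 3 w p) ^ 2) +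
    ((Lb 1 w p) ^ 2 + (Lb 2 w p) ^ 2 + (Lb 3 w p) ^ 2)

/-- The Morawetz multiplier. -/
def Km (w : Pt → ℝ) : Pt → ℝ := fun p =>
  p 0 * (Sc w p + 2 * w p) + (p 1 * Lb 1 w p + p 2 * Lb 2 w p + p 3 * Lb 3 w p)

/-- The flux. -/
def Jf (a : Fin 4) (w : Pt → ℝ) : Pt → ℝ := fun p =>
  2 * (p 0 * p 0 + p 1 * p 1 + p 2 * p 2 + p 3 * p 3) * (pd 0 w p * pd a w p)
  + 2 * p 0 * p a * (pd 0 w p * pd 0 w p - pd 1 w p * pd 1 w p - pd 2 w p * pd 2 w p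
      - pd 3 w p * pd 3 w p)
  + 4 * p 0 * (p 1 * pd 1 w p + p 2 * pd 2 w p + p 3 * pd 3 w p) * pd a w p
  + 4 * p 0 * (w p * pd a w p) + 4 * p a * (w p * pd 0 w p)

lemma ident_aux (w w0 w1 w2 w3 : Pt → ℝ) (hw : Differentiable ℝ w) (h0 : Differentiable ℝ w0)
    (h1 : Differentiable ℝ w1) (h2 : Differentiable ℝ w2) (h3 : Differentiable ℝ w3)
    (e0 : pd 0 w = w0) (e1 : pd 1 w = w1) (e2 : pd 2 w = w2) (e3 : pd 3 w = w3)
    (s : ∀ i j, pd i (pd j w) = pd j (pd i w)) (p : Pt) :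
    pd 0 (qd w) p = 2 * (Km w p * box w p) + (pd 1 (Jf 1 w) p + pd 2 (Jf 2 w) p + pd 3 (Jf 3 w) p)
    := by
  have s1 := s 1 0
  have s2 := s 2 0
  have s3 := s 3 0
  have s12 := s 2 1
  have s13 := s 3 1
  have s23 := s 3 2
  unfold qd Km Jf box Sc Omg Lb
  simp only [Fin.sum_univ_four, pow_two]
  rw [e0, e1] at s1
  rw [e0, e2] at s2
  rw [e0, e3] at s3
  rw [e1, e2] at s12
  rw [e1, e3] at s13
  rw [e2, e3] at s23
  simp only [e0, e1, e2, e3]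
  simp (disch := fun_prop) only [pd_add', pd_sub', pd_mul', pd_const', pd_coord, e0, e1, e2, e3,
    s1, s2, s3, s12, s13, s23]
  simp
  ring

lemma ident2_aux (w w0 w1 w2 w3 : Pt → ℝ) (hw : Differentiable ℝ w)
    (e0 : pd 0 w = w0) (e1 : pd 1 w = w1) (e2 : pd 2 w = w2) (e3 : pd 3 w = w3) (p : Pt) :
    pd 0 (fun p => p 0 * (w p * w p)) p = 2 * (w p * (Sc w p + 2 * w p))
      - (pd 1 (fun p => p 1 * (w p * w p)) p + pd 2 (fun p => p 2 * (w p * w p)) p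
        + pd 3 (fun p => p 3 * (w p * w p)) p) := by
  unfold Sc
  simp only [Fin.sum_univ_four]
  simp (disch := fun_prop) only [pd_mul', pd_coord, e0, e1, e2, e3]
  simp
  ring

lemma pd_smooth (i : Fin 4) {w : Pt → ℝ} (hw : ContDiff ℝ (⊤ : ℕ∞) w) :
    ContDiff ℝ (⊤ : ℕ∞) (pd i w) := by
  have h : ContDiff ℝ (⊤ : ℕ∞) (fderiv ℝ w) := hw.fderiv_right (by exact_mod_cast le_top)
  exact h.clm_apply contDiff_const

lemma pd_symm {w : Pt → ℝ} (hw : ContDiff ℝ (⊤ : ℕ∞) w) (i j : Fin 4) :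
    pd i (pd j w) = pd j (pd i w) := by
  have h : ContDiff ℝ (⊤ : ℕ∞) (fderiv ℝ w) := hw.fderiv_right (by exact_mod_cast le_top)
  have hd : Differentiable ℝ (fderiv ℝ w) := h.differentiable (by simp)
  have key : ∀ i j : Fin 4, ∀ p, pd i (pd j w) p
      = fderiv ℝ (fderiv ℝ w) p (Pi.single i 1) (Pi.single j 1) := by
    intro i j p
    have : HasFDerivAt (pd j w) _ p := (hd p).hasFDerivAt.clm_apply
      (hasFDerivAt_const (Pi.single j (1:ℝ) : Pt) p)
    unfold pd at this ⊢
    rw [this.fderiv]; simp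
  funext p
  rw [key, key]
  have := (hw.contDiffAt (x := p)).isSymmSndFDerivAt (by
    rw [minSmoothness_of_isRCLikeNormedField]
    exact WithTop.coe_le_coe.2 (le_top : (2 : ℕ∞) ≤ ⊤))
  exact this _ _

lemma ident {w : Pt → ℝ} (hw : ContDiff ℝ (⊤ : ℕ∞) w) (p : Pt) :
    pd 0 (qd w) p = 2 * (Km w p * box w p) + (pd 1 (Jf 1 w) p + pd 2 (Jf 2 w) p + pd 3 (Jf 3 w) p)
    := ident_aux w _ _ _ _ (hw.differentiable (by simp)) ((pd_smooth 0 hw).differentiable (by simp))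
      ((pd_smooth 1 hw).differentiable (by simp)) ((pd_smooth 2 hw).differentiable (by simp))
      ((pd_smooth 3 hw).differentiable (by simp)) rfl rfl rfl rfl (pd_symm hw) p

lemma ident2 {w : Pt → ℝ} (hw : ContDiff ℝ (⊤ : ℕ∞) w) (p : Pt) :
    pd 0 (fun p => p 0 * (w p * w p)) p = 2 * (w p * (Sc w p + 2 * w p))
      - (pd 1 (fun p => p 1 * (w p * w p)) p + pd 2 (fun p => p 2 * (w p * w p)) p
        + pd 3 (fun p => p 3 * (w p * w p)) p) :=
  ident2_aux w _ _ _ _ (hw.differentiable (by simp)) rfl rfl rfl rfl p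


/-- Integral over a sup-norm ball at fixed time. -/
def IK (R : ℝ) (f : Pt → ℝ) (t : ℝ) : ℝ := ∫ x in Metric.closedBall (0 : Sp) R, f (pt t x)

lemma pt_cont : Continuous (fun z : ℝ × Sp => pt z.1 z.2) := by
  unfold pt
  refine continuous_pi fun i => ?_
  refine Fin.cases ?_ (fun j => ?_) i
  · simpa using continuous_fst
  · simp only [Fin.cons_succ]; fun_prop

lemma pt_contx (t : ℝ) : Continuous (fun x : Sp => pt t x) :=
  pt_cont.comp (by fun_prop : Continuous fun x : Sp => (t, x))

lemma pt_contt (x : Sp) : Continuous (fun t : ℝ => pt t x) :=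
  pt_cont.comp (by fun_prop : Continuous fun t : ℝ => (t, x))

lemma IK_cont (R : ℝ) {f : Pt → ℝ} (hf : Continuous f) : Continuous (IK R f) :=
  continuous_parametric_integral_of_continuous (f := fun t x => f (pt t x))
    (hf.comp pt_cont) (isCompact_closedBall 0 R)

lemma IK_int (R t : ℝ) {f : Pt → ℝ} (hf : Continuous f) :
    IntegrableOn (fun x => f (pt t x)) (Metric.closedBall (0 : Sp) R) :=
  (hf.comp (pt_contx t)).continuousOn.integrableOn_compact (isCompact_closedBall 0 R)

lemma pt_hasDerivAt (x : Sp) (t : ℝ) : HasDerivAt (fun s => pt s x) (Pi.single 0 1) t := by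
  rw [hasDerivAt_pi]
  intro i
  refine Fin.cases ?_ (fun j => ?_) i
  · simpa [pt] using hasDerivAt_id' t
  · simpa [pt] using hasDerivAt_const t (x j)

lemma pd_zero_hasDerivAt {f : Pt → ℝ} (hf : Differentiable ℝ f) (x : Sp) (t : ℝ) :
    HasDerivAt (fun s => f (pt s x)) (pd 0 f (pt t x)) t :=
  (hf (pt t x)).hasFDerivAt.comp_hasDerivAt t (pt_hasDerivAt x t)

lemma pt_hasFDerivAt (t : ℝ) (x : Sp) : HasFDerivAt (fun y => pt t y)
    (ContinuousLinearMap.pi (Fin.cons 0 (fun j => ContinuousLinearMap.proj j)) : Sp →L[ℝ] Pt) x := by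
  rw [hasFDerivAt_pi']
  intro i
  refine Fin.cases ?_ (fun j => ?_) i
  · simpa [pt] using hasFDerivAt_const t x
  · simpa [pt] using hasFDerivAt_apply j x

lemma pd_succ_eq {f : Pt → ℝ} (hf : Differentiable ℝ f) (t : ℝ) (x : Sp) (a : Fin 3) :
    fderiv ℝ (fun y => f (pt t y)) x (Pi.single a 1) = pd a.succ f (pt t x) := by
  have h := (hf (pt t x)).hasFDerivAt.comp x (pt_hasFDerivAt t x)
  have h' : HasFDerivAt (fun y => f (pt t y)) _ x := h
  rw [h'.fderiv]
  unfold pd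
  simp only [ContinuousLinearMap.comp_apply]
  congr 1
  funext i
  refine Fin.cases ?_ (fun j => ?_) i
  · simp
  · simp [Pi.single_apply]

lemma pd_cont {f : Pt → ℝ} (hf : ContDiff ℝ 1 f) (i : Fin 4) : Continuous (pd i f) :=
  (hf.continuous_fderiv (by simp)).clm_apply continuous_const

lemma IK_deriv (R : ℝ) {f : Pt → ℝ} (hf : ContDiff ℝ 1 f) (t : ℝ) :
    HasDerivAt (IK R f) (IK R (pd 0 f) t) t := by
  have hc : Continuous (fun z : ℝ × Sp => pd 0 f (pt z.1 z.2)) := (pd_cont hf 0).comp pt_cont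
  obtain ⟨M, hM⟩ := ((isCompact_closedBall t 1).prod
    (isCompact_closedBall (0 : Sp) R)).bddAbove_image hc.norm.continuousOn
  refine (hasDerivAt_integral_of_dominated_loc_of_deriv_le (F := fun s x => f (pt s x))
    (F' := fun s x => pd 0 f (pt s x)) (bound := fun _ => M)
    (Metric.closedBall_mem_nhds t one_pos) ?_ ?_ ?_ ?_ ?_ ?_).2
  · exact Filter.Eventually.of_forall fun s =>
      (hf.continuous.comp (pt_contx s)).aestronglyMeasurable
  · exact IK_int R t hf.continuous
  · exact ((pd_cont hf 0).comp (pt_contx t)).aestronglyMeasurable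
  · refine (ae_restrict_iff' Metric.isClosed_closedBall.measurableSet).2
      (Filter.Eventually.of_forall fun x hx s hs => ?_)
    exact hM ⟨(s, x), ⟨hs, hx⟩, rfl⟩
  · exact integrableOn_const (isCompact_closedBall 0 R).measure_lt_top.ne
  · exact Filter.Eventually.of_forall fun x s _ =>
      pd_zero_hasDerivAt (hf.differentiable (by simp)) x s

lemma IK_eq (R t : ℝ) {f : Pt → ℝ} (h : ∀ x : Sp, R < ‖x‖ → f (pt t x) = 0) :
    IK R f t = ∫ x, f (pt t x) := by
  unfold IK
  refine setIntegral_eq_integral_of_forall_compl_eq_zero fun x hx => h x ?_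
  simpa using hx

lemma IK_div (R t : ℝ) {f : Pt → ℝ} (hf : ContDiff ℝ 1 f)
    (h : ∀ x : Sp, R < ‖x‖ → f (pt t x) = 0) (a : Fin 3) : IK R (pd a.succ f) t = 0 := by
  have hd : Differentiable ℝ f := hf.differentiable (by simp)
  have hz : ∀ x : Sp, R < ‖x‖ → pd a.succ f (pt t x) = 0 := by
    intro x hx
    rw [← pd_succ_eq hd]
    have : (fun y => f (pt t y)) =ᶠ[nhds x] fun _ => 0 := by
      filter_upwards [(isOpen_lt continuous_const continuous_norm).mem_nhds hx] with y hy
      exact h y hy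
    rw [this.fderiv_eq]; simp
  rw [IK_eq R t hz]
  have hcs : ∀ g : Sp → ℝ, Continuous g → (∀ x, R < ‖x‖ → g x = 0) → Integrable g := by
    intro g hg hg0
    refine hg.integrable_of_hasCompactSupport ?_
    refine HasCompactSupport.intro (isCompact_closedBall (0:Sp) R) fun x hx => hg0 x ?_
    simpa using hx
  have key := integral_mul_fderiv_eq_neg_fderiv_mul_of_integrable (μ := (volume : Measure Sp))
    (f := fun _ : Sp => (1 : ℝ)) (g := fun y => f (pt t y)) (v := Pi.single a 1)
    (by simp) (by
      simp only [pd_succ_eq hd, one_mul]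
      exact hcs _ ((pd_cont hf _).comp (pt_contx t)) hz)
    (by
      simp only [one_mul]
      exact hcs _ (hf.continuous.comp (pt_contx t)) h)
    (fun x _ => by fun_prop)
    (fun x _ => ((hd _).comp x (pt_hasFDerivAt t x).differentiableAt))
  simpa [pd_succ_eq hd] using key

lemma IK_cs (R t : ℝ) {f g : Pt → ℝ} (hf : Continuous f) (hg : Continuous g) :
    IK R (fun p => f p * g p) t
      ≤ Real.sqrt (IK R (fun p => f p ^ 2) t) * Real.sqrt (IK R (fun p => g p ^ 2) t) := by
  have hA : 0 ≤ IK R (fun p => f p ^ 2) t := integral_nonneg fun x => sq_nonneg _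
  have key : ∀ s : ℝ, 0 ≤ IK R (fun p => f p ^ 2) t * (s * s)
      + 2 * IK R (fun p => f p * g p) t * s + IK R (fun p => g p ^ 2) t := by
    intro s
    have : 0 ≤ IK R (fun p => (f p * s + g p) ^ 2) t := integral_nonneg fun x => sq_nonneg _
    refine this.trans_eq ?_
    unfold IK
    have e : ∀ x : Sp, (f (pt t x) * s + g (pt t x)) ^ 2 = (f (pt t x) ^ 2 * (s * s)
      + f (pt t x) * g (pt t x) * (2 * s)) + g (pt t x) ^ 2 := fun x => by ring
    simp only [e]
    rw [integral_add, integral_add, integral_mul_const, integral_mul_const]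
    · ring
    · exact IK_int R t (f := fun p => f p ^ 2 * (s * s)) (by fun_prop)
    · exact IK_int R t (f := fun p => f p * g p * (2 * s)) (by fun_prop)
    · exact IK_int R t (f := fun p => f p ^ 2 * (s * s) + f p * g p * (2 * s)) (by fun_prop)
    · exact IK_int R t (f := fun p => g p ^ 2) (by fun_prop)
  have hd := discrim_le_zero key
  unfold discrim at hd
  rw [← Real.sqrt_mul hA]
  refine Real.le_sqrt_of_sq_le ?_
  nlinarith

lemma IK_mono (R t : ℝ) {f g : Pt → ℝ} (hf : Continuous f) (hg : Continuous g)
    (h : ∀ x, f (pt t x) ≤ g (pt t x)) : IK R f t ≤ IK R g t :=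
  integral_mono (IK_int R t hf) (IK_int R t hg) h

lemma gron (G G' B : ℝ → ℝ) (T : ℝ) (hT : 0 ≤ T) (hG : ∀ s, 0 ≤ G s)
    (hd : ∀ s, HasDerivAt G (G' s) s) (hB : Continuous B) (hB0 : ∀ s, 0 ≤ B s)
    (h : ∀ s ∈ Set.Ioo 0 T, G' s ≤ 2 * (Real.sqrt (G s) * B s)) :
    Real.sqrt (G T) ≤ Real.sqrt (G 0) + ∫ s in (0:ℝ)..T, B s := by
  refine le_of_forall_pos_le_add fun ε hε => ?_
  have hε2 : 0 < ε ^ 2 := by positivity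
  have hpos : ∀ s, 0 < G s + ε ^ 2 := fun s => by linarith [hG s]
  have hder : ∀ s, HasDerivAt (fun s => Real.sqrt (G s + ε ^ 2))
      (G' s / (2 * Real.sqrt (G s + ε ^ 2))) s := fun s =>
    ((hd s).add_const (ε ^ 2)).sqrt (hpos s).ne'
  have key := intervalIntegral.sub_le_integral_of_hasDeriv_right_of_le (φ := B) hT
    (g := fun s => Real.sqrt (G s + ε ^ 2)) (fun s _ => (hder s).continuousAt.continuousWithinAt)
    (fun s _ => (hder s).hasDerivWithinAt) hB.continuousOn.integrableOn_Icc
    (by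
      intro s hs
      have h1 : 0 < Real.sqrt (G s + ε ^ 2) := Real.sqrt_pos.2 (hpos s)
      rw [div_le_iff₀ (by positivity)]
      have h2 : Real.sqrt (G s) ≤ Real.sqrt (G s + ε ^ 2) := Real.sqrt_le_sqrt (by linarith)
      have h3 := mul_le_mul_of_nonneg_right h2 (hB0 s)
      linarith [h s hs])
  have h4 : Real.sqrt (G T) ≤ Real.sqrt (G T + ε ^ 2) := Real.sqrt_le_sqrt (by linarith)
  have h5 : Real.sqrt (G 0 + ε ^ 2) ≤ Real.sqrt (G 0) + ε := by
    refine Real.sqrt_le_iff.2 ⟨by positivity, ?_⟩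
    nlinarith [Real.sq_sqrt (hG 0), Real.sqrt_nonneg (G 0)]
  linarith

lemma IK_add (R t : ℝ) {f g : Pt → ℝ} (hf : Continuous f) (hg : Continuous g) :
    IK R (fun p => f p + g p) t = IK R f t + IK R g t :=
  integral_add (IK_int R t hf) (IK_int R t hg)

lemma IK_cmul (R t c : ℝ) (f : Pt → ℝ) : IK R (fun p => c * f p) t = c * IK R f t :=
  integral_const_mul c _

/-- Bound for the L² norm from the scaling identity. -/
lemma ybound (Y Q : ℝ → ℝ) (T A : ℝ) (hT : 0 ≤ T) (hA : 0 ≤ A) (hY : ∀ s, 0 ≤ Y s)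
    (hYc : Continuous Y) (hd : ∀ s, HasDerivAt (fun s => s * Y s) (Q s) s)
    (h : ∀ s ∈ Set.Ioo 0 T, Q s ≤ 2 * (Real.sqrt (Y s) * A)) :
    Real.sqrt (Y T) ≤ Real.sqrt (Y 0) + 2 * A := by
  obtain ⟨m, hm, hmax⟩ := (isCompact_Icc (a := (0:ℝ)) (b := T)).exists_isMaxOn
    ⟨0, Set.left_mem_Icc.2 hT⟩ hYc.continuousOn
  have hle : ∀ s ∈ Set.Icc 0 T, Y s ≤ Y m := fun s hs => hmax hs
  have hTm : Real.sqrt (Y T) ≤ Real.sqrt (Y m) :=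
    Real.sqrt_le_sqrt (hle T (Set.right_mem_Icc.2 hT))
  refine hTm.trans ?_
  rcases hm.1.eq_or_lt with h0 | h0
  · rw [← h0]; linarith
  have key := intervalIntegral.sub_le_integral_of_hasDeriv_right_of_le
    (φ := fun _ => 2 * (Real.sqrt (Y m) * A)) hm.1
    (g := fun s => s * Y s) (fun s _ => (hd s).continuousAt.continuousWithinAt)
    (fun s _ => (hd s).hasDerivWithinAt) continuous_const.continuousOn.integrableOn_Icc
    (by
      intro s hs
      refine (h s ⟨hs.1, hs.2.trans_le hm.2⟩).trans ?_
      have := Real.sqrt_le_sqrt (hle s ⟨hs.1.le, hs.2.le.trans hm.2⟩)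
      have := mul_le_mul_of_nonneg_right this hA
      linarith)
  simp only [intervalIntegral.integral_const, smul_eq_mul] at key
  have h1 : Y m ≤ 2 * (Real.sqrt (Y m) * A) := by
    have : m * Y m ≤ m * (2 * (Real.sqrt (Y m) * A)) := by linarith
    exact le_of_mul_le_mul_left this h0
  have h2 := Real.sq_sqrt (hY m)
  have h3 := Real.sqrt_nonneg (Y 0)
  by_contra hc
  push Not at hc
  have h4 : 2 * A < Real.sqrt (Y m) := by linarith
  nlinarith

lemma IK_comb (R t c d : ℝ) {f g1 g2 g3 : Pt → ℝ} (hf : Continuous f) (h1 : Continuous g1)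
    (h2 : Continuous g2) (h3 : Continuous g3) (z1 : IK R g1 t = 0) (z2 : IK R g2 t = 0)
    (z3 : IK R g3 t = 0) :
    IK R (fun p => c * f p + d * (g1 p + g2 p + g3 p)) t = c * IK R f t := by
  rw [IK_add R t (f := fun p => c * f p) (g := fun p => d * (g1 p + g2 p + g3 p)) (by fun_prop)
    (by fun_prop), IK_cmul, IK_cmul, IK_add R t (f := fun p => g1 p + g2 p) (by fun_prop) h3,
    IK_add R t h1 h2, z1, z2, z3]
  ring

lemma norm_le_rnorm (x : Sp) : ‖x‖ ≤ rnorm x := by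
  refine (pi_norm_le_iff_of_nonneg (Real.sqrt_nonneg _)).2 fun i => ?_
  refine Real.le_sqrt_of_sq_le ?_
  rw [Real.norm_eq_abs, sq_abs]
  exact Finset.single_le_sum (f := fun a => x a ^ 2) (fun a _ => sq_nonneg _) (Finset.mem_univ i)

lemma van {f : Pt → ℝ} {R T : ℝ}
    (h : ∀ (s : ℝ) (x : Sp), 0 < s → s < T → R < ‖x‖ → f (pt s x) = 0) (i : Fin 4) :
    ∀ (s : ℝ) (x : Sp), 0 < s → s < T → R < ‖x‖ → pd i f (pt s x) = 0 := by
  intro s x h0 hT hx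
  have ho : IsOpen {p : Pt | 0 < p 0 ∧ p 0 < T ∧ R < ‖(Fin.tail p : Sp)‖} := by
    have hc : Continuous fun p : Pt => (Fin.tail p : Sp) :=
      continuous_pi fun j => continuous_apply j.succ
    exact (isOpen_lt continuous_const (continuous_apply 0)).inter
      ((isOpen_lt (continuous_apply 0) continuous_const).inter
        (isOpen_lt continuous_const hc.norm))
  have hev : f =ᶠ[nhds (pt s x)] fun _ => 0 := by
    filter_upwards [ho.mem_nhds (show pt s x ∈ _ from ⟨h0, hT, by simpa [pt] using hx⟩)] with p hp
    have : p = pt (p 0) (Fin.tail p) := (Fin.cons_self_tail p).symm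
    rw [this]
    exact h _ _ hp.1 hp.2.1 hp.2.2
  unfold pd
  rw [hev.fderiv_eq]; simp

lemma van_closed {f : Pt → ℝ} (hf : Continuous f) {R T : ℝ} (hT0 : 0 < T)
    (h : ∀ (s : ℝ) (x : Sp), 0 < s → s < T → R < ‖x‖ → f (pt s x) = 0) :
    ∀ (s : ℝ) (x : Sp), 0 ≤ s → s < T → R < ‖x‖ → f (pt s x) = 0 := by
  intro s x h0 hT hx
  rcases h0.eq_or_lt with rfl | h0
  · have hcl : IsClosed {s : ℝ | f (pt s x) = 0} :=
      isClosed_eq (hf.comp (pt_contt x)) continuous_const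
    have hsub : Set.Ioo 0 T ⊆ {s : ℝ | f (pt s x) = 0} := fun s hs => h s x hs.1 hs.2 hx
    have := hcl.closure_subset_iff.2 hsub
    rw [closure_Ioo hT0.ne] at this
    exact this ⟨le_rfl, hT0.le⟩
  · exact h s x h0 hT hx

lemma Km_bound (w : Pt → ℝ) (p : Pt) (hp : 0 ≤ p 0) :
    |Km w p| ≤ Real.sqrt (qd w p) *
      Real.sqrt (1 + (p 0 + Real.sqrt (p 1 ^ 2 + p 2 ^ 2 + p 3 ^ 2)) ^ 2) := by
  set ρ := Real.sqrt (p 1 ^ 2 + p 2 ^ 2 + p 3 ^ 2) with hρ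
  have hρ0 : 0 ≤ ρ := Real.sqrt_nonneg _
  have hρ2 : ρ ^ 2 = p 1 ^ 2 + p 2 ^ 2 + p 3 ^ 2 := Real.sq_sqrt (by positivity)
  have hq : 0 ≤ qd w p := by unfold qd; positivity
  rw [← Real.sqrt_mul hq]
  refine Real.abs_le_sqrt ?_
  have h1 : Km w p ^ 2 ≤ qd w p * (p 0 ^ 2 + p 1 ^ 2 + p 2 ^ 2 + p 3 ^ 2) := by
    unfold Km qd
    generalize Sc w p + 2 * w p = a
    generalize Lb 1 w p = b
    generalize Lb 2 w p = c
    generalize Lb 3 w p = d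
    generalize Omg 1 2 w p = e
    generalize Omg 1 3 w p = f
    generalize Omg 2 3 w p = g
    generalize p 0 = x
    generalize p 1 = y
    generalize p 2 = z
    generalize p 3 = u
    have : 0 ≤ (e ^ 2 + f ^ 2 + g ^ 2) * (x ^ 2 + y ^ 2 + z ^ 2 + u ^ 2) := by positivity
    nlinarith [sq_nonneg (x * b - y * a), sq_nonneg (x * c - z * a), sq_nonneg (x * d - u * a),
      sq_nonneg (y * c - z * b), sq_nonneg (y * d - u * b), sq_nonneg (z * d - u * c)]
  refine h1.trans (mul_le_mul_of_nonneg_left ?_ hq)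
  nlinarith [mul_nonneg hp hρ0]

theorem main_est (w Ψ : Pt → ℝ) (hw : ContDiff ℝ (⊤ : ℕ∞) w)
    (hs : ∀ T : ℝ, ∃ R : ℝ, ∀ (t : ℝ) (x : Sp), 0 ≤ t → t ≤ T → R ≤ rnorm x → w (pt t x) = 0)
    (hΨ : ∀ p : Pt, box w p = Ψ p) (T : ℝ) (hT : 0 ≤ T) :
    Real.sqrt (Fen w T) ≤ 27 * (Real.sqrt (Fen w 0) +
      ∫ τ in (0:ℝ)..T, L2norm (fun x => jb (τ + rnorm x) * Ψ (pt τ x))) := by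
  obtain ⟨R, hR⟩ := hs (T + 1)
  have hT1 : 0 < T + 1 := by linarith
  have hs0 : ∀ (s : ℝ) (x : Sp), 0 < s → s < T + 1 → R < ‖x‖ → w (pt s x) = 0 :=
    fun s x h0 h1 h2 => hR s x h0.le h1.le (h2.le.trans (norm_le_rnorm x))
  have hpdc : ∀ i, ContDiff ℝ (⊤ : ℕ∞) (pd i w) := fun i => pd_smooth i hw
  have hwc : Continuous w := hw.continuous
  have zw := van_closed hwc hT1 hs0
  have zd : ∀ i, ∀ (s : ℝ) (x : Sp), 0 ≤ s → s < T + 1 → R < ‖x‖ → pd i w (pt s x) = 0 :=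
    fun i => van_closed (hpdc i).continuous hT1 (van hs0 i)
  have zdd : ∀ i j, ∀ (s : ℝ) (x : Sp), 0 ≤ s → s < T + 1 → R < ‖x‖ →
      pd i (pd j w) (pt s x) = 0 :=
    fun i j => van_closed (pd_smooth i (hpdc j)).continuous hT1 (van (van hs0 j) i)
  have zΨ : ∀ (s : ℝ) (x : Sp), 0 ≤ s → s < T + 1 → R < ‖x‖ → Ψ (pt s x) = 0 := by
    intro s x h0 h1 h2
    rw [← hΨ, box]
    simp [zdd _ _ s x h0 h1 h2]
  have hΨc : Continuous Ψ := by
    have : Ψ = box w := by funext p; exact (hΨ p).symm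
    rw [this]
    have h := fun i => (pd_smooth i (hpdc i)).continuous
    exact (h 0).sub (((h 1).add (h 2)).add (h 3))
  have hco : ∀ i : Fin 4, ContDiff ℝ (⊤ : ℕ∞) (fun p : Pt => p i) := fun i => contDiff_apply ℝ ℝ i
  have hSc : ContDiff ℝ (⊤ : ℕ∞) (Sc w) := ContDiff.sum fun i _ => (hco i).mul (hpdc i)
  have hOmg : ∀ a b, ContDiff ℝ (⊤ : ℕ∞) (Omg a b w) := fun a b =>
    ((hco a).mul (hpdc b)).sub ((hco b).mul (hpdc a))
  have hLb : ∀ a, ContDiff ℝ (⊤ : ℕ∞) (Lb a w) := fun a =>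
    ((hco a).mul (hpdc 0)).add ((hco 0).mul (hpdc a))
  have hSw : ContDiff ℝ (⊤ : ℕ∞) (fun p => Sc w p + 2 * w p) := hSc.add (contDiff_const.mul hw)
  have hq : ContDiff ℝ (⊤ : ℕ∞) (qd w) :=
    ((hSw.pow 2).add ((((hOmg 1 2).pow 2).add ((hOmg 1 3).pow 2)).add ((hOmg 2 3).pow 2))).add
      ((((hLb 1).pow 2).add ((hLb 2).pow 2)).add ((hLb 3).pow 2))
  have hKm : ContDiff ℝ (⊤ : ℕ∞) (Km w) := ((hco 0).mul hSw).add
    ((((hco 1).mul (hLb 1)).add ((hco 2).mul (hLb 2))).add ((hco 3).mul (hLb 3)))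
  have hJ : ∀ a, ContDiff ℝ (⊤ : ℕ∞) (Jf a w) := by
    intro a
    have h0 := hpdc 0
    have h1 := hpdc 1
    have h2 := hpdc 2
    have h3 := hpdc 3
    have ha := hpdc a
    unfold Jf
    generalize pd 0 w = w0 at *
    generalize pd 1 w = w1 at *
    generalize pd 2 w = w2 at *
    generalize pd 3 w = w3 at *
    generalize pd a w = wa at *
    fun_prop
  have one_le : (1 : WithTop ℕ∞) ≤ ((⊤ : ℕ∞) : WithTop ℕ∞) := by exact_mod_cast le_top
  have hxw : ∀ i : Fin 4, ContDiff ℝ (⊤ : ℕ∞) (fun p : Pt => p i * (w p * w p)) :=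
    fun i => (hco i).mul (hw.mul hw)
  set G := IK R (qd w) with hG
  set Y := IK R (fun p => w p ^ 2) with hY
  let g : Pt → ℝ := fun p =>
    Real.sqrt (1 + (p 0 + Real.sqrt (p 1 ^ 2 + p 2 ^ 2 + p 3 ^ 2)) ^ 2) * |Ψ p|
  have hgc : Continuous g := by fun_prop
  set B : ℝ → ℝ := fun s => Real.sqrt (IK R (fun p => g p ^ 2) s) with hB
  have hBc : Continuous B := (IK_cont R (hgc.pow 2)).sqrt
  have hqn : ∀ p, 0 ≤ qd w p := fun p => by unfold qd; positivity
  have hGn : ∀ s, 0 ≤ G s := fun s => integral_nonneg fun x => hqn _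
  have hYn : ∀ s, 0 ≤ Y s := fun s => integral_nonneg fun x => sq_nonneg _
  have hB0 : ∀ s, 0 ≤ B s := fun s => Real.sqrt_nonneg _
  have hGder : ∀ s, HasDerivAt G (IK R (pd 0 (qd w)) s) s := IK_deriv R (hq.of_le one_le)
  have hG' : ∀ s ∈ Set.Ioo 0 (T + 1),
      IK R (pd 0 (qd w)) s ≤ 2 * (Real.sqrt (G s) * B s) := by
    intro s hs
    have e : pd 0 (qd w) = fun p => 2 * (Km w p * Ψ p) +
        1 * (pd 1 (Jf 1 w) p + pd 2 (Jf 2 w) p + pd 3 (Jf 3 w) p) := by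
      funext p; rw [ident hw p, hΨ, one_mul]
    have hJc : ∀ i a, Continuous (pd i (Jf a w)) := fun i a => (pd_smooth i (hJ a)).continuous
    have hJ0 : ∀ (a : Fin 4) (x : Sp), R < ‖x‖ → Jf a w (pt s x) = 0 := by
      intro a x hx
      simp [Jf, zw s x hs.1.le hs.2 hx, zd _ s x hs.1.le hs.2 hx]
    have hd : ∀ a : Fin 3, IK R (pd a.succ (Jf a.succ w)) s = 0 := fun a =>
      IK_div R s ((hJ _).of_le one_le) (hJ0 _) a
    have d1 : IK R (pd 1 (Jf 1 w)) s = 0 := hd 0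
    have d2 : IK R (pd 2 (Jf 2 w)) s = 0 := hd 1
    have d3 : IK R (pd 3 (Jf 3 w)) s = 0 := hd 2
    have hKc := hKm.continuous
    have hqc := hq.continuous
    rw [e, IK_comb R s 2 1 (f := fun p => Km w p * Ψ p) (hKc.mul hΨc) (hJc 1 1) (hJc 2 2) (hJc 3 3) d1 d2 d3]
    have h1 : IK R (fun p => Km w p * Ψ p) s ≤ IK R (fun p => Real.sqrt (qd w p) * g p) s := by
      refine IK_mono R s (by fun_prop) (by fun_prop) fun x => ?_
      have hb := Km_bound w (pt s x) (by simpa [pt] using hs.1.le)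
      calc _ ≤ |Km w (pt s x)| * |Ψ (pt s x)| := by rw [← abs_mul]; exact le_abs_self _
        _ ≤ _ := mul_le_mul_of_nonneg_right hb (abs_nonneg _)
        _ = _ := by simp only [g]; ring
    have h2 := IK_cs R s (f := fun p => Real.sqrt (qd w p)) (g := g) (by fun_prop) hgc
    simp only [Real.sq_sqrt (hqn _)] at h2
    have h3 : IK R (fun p => Km w p * Ψ p) s ≤ Real.sqrt (G s) * B s := h1.trans h2
    linarith
  have hYc : Continuous Y := IK_cont R (hwc.pow 2)
  have hInt0 : ∀ s, 0 ≤ s → 0 ≤ ∫ τ in (0:ℝ)..s, B τ := fun s h =>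
    intervalIntegral.integral_nonneg h fun u _ => hB0 u
  set I := ∫ τ in (0:ℝ)..T, B τ with hI
  set A := Real.sqrt (G 0) + I with hA
  have hI0 : 0 ≤ I := hInt0 T hT
  have hA0 : 0 ≤ A := by positivity
  have hGA : ∀ s ∈ Set.Icc 0 T, Real.sqrt (G s) ≤ A := by
    intro s hs
    have h1 := gron G _ B s hs.1 hGn hGder hBc hB0
      (fun u hu => hG' u ⟨hu.1, by linarith [hu.2, hs.2]⟩)
    have h2 : ∫ τ in (0:ℝ)..s, B τ ≤ I := by
      refine intervalIntegral.integral_mono_interval le_rfl hs.1 hs.2 ?_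
        (hBc.intervalIntegrable _ _)
      exact Filter.Eventually.of_forall hB0
    linarith
  have hYder : ∀ s, HasDerivAt (fun s => s * Y s)
      (IK R (pd 0 (fun p => p 0 * (w p * w p))) s) s := by
    intro s
    have h := IK_deriv R ((hxw 0).of_le one_le) s
    convert h using 1
    funext u
    rw [hY]
    unfold IK
    rw [← integral_const_mul]
    congr 1
    funext x
    have h0 : pt u x 0 = u := rfl
    simp only [h0]; ring
  have hY' : ∀ s ∈ Set.Ioo 0 T,
      IK R (pd 0 (fun p => p 0 * (w p * w p))) s ≤ 2 * (Real.sqrt (Y s) * A) := by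
    intro s hs
    have e : pd 0 (fun p => p 0 * (w p * w p)) = fun p => 2 * (w p * (Sc w p + 2 * w p)) +
        (-1) * (pd 1 (fun p => p 1 * (w p * w p)) p + pd 2 (fun p => p 2 * (w p * w p)) p
        + pd 3 (fun p => p 3 * (w p * w p)) p) := by
      funext p; rw [ident2 hw p]; ring
    have hc : ∀ i a, Continuous (pd i (fun p => p a * (w p * w p))) :=
      fun i a => (pd_smooth i (hxw a)).continuous
    have hd : ∀ a : Fin 3, IK R (pd a.succ (fun p => p a.succ * (w p * w p))) s = 0 := fun a =>
      IK_div R s ((hxw _).of_le one_le)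
        (fun x hx => by simp [zw s x hs.1.le (by linarith [hs.2]) hx]) a
    have d1 : IK R (pd 1 (fun p => p 1 * (w p * w p))) s = 0 := hd 0
    have d2 : IK R (pd 2 (fun p => p 2 * (w p * w p))) s = 0 := hd 1
    have d3 : IK R (pd 3 (fun p => p 3 * (w p * w p))) s = 0 := hd 2
    have hSwc := hSw.continuous
    rw [e, IK_comb R s 2 (-1) (f := fun p => w p * (Sc w p + 2 * w p)) (hwc.mul hSwc) (hc 1 1) (hc 2 2) (hc 3 3) d1 d2 d3]
    have h2 := IK_cs R s (f := w) (g := fun p => Sc w p + 2 * w p) hwc hSwc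
    have h3 : IK R (fun p => (Sc w p + 2 * w p) ^ 2) s ≤ G s := by
      refine IK_mono R s (hSwc.pow 2) hq.continuous fun x => ?_
      unfold qd
      have : ∀ a b c d e f g : ℝ, a ^ 2 ≤ a ^ 2 + (b ^ 2 + c ^ 2 + d ^ 2)
        + (e ^ 2 + f ^ 2 + g ^ 2) := fun a b c d e f g => by
          nlinarith [sq_nonneg b, sq_nonneg c,
          sq_nonneg d, sq_nonneg e, sq_nonneg f, sq_nonneg g]
      exact this _ _ _ _ _ _ _
    have h4 := (Real.sqrt_le_sqrt h3).trans (hGA s ⟨hs.1.le, hs.2.le⟩)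
    have h5 := mul_le_mul_of_nonneg_left h4 (Real.sqrt_nonneg (Y s))
    have h6 : IK R (fun p => w p * (Sc w p + 2 * w p)) s ≤ Real.sqrt (Y s) * A := h2.trans h5
    linarith
  have hYT := ybound Y _ T A hT hA0 hYn hYc hYder hY'
  let fd : Pt → ℝ := fun p => w p ^ 2 +
    ((Omg 1 2 w p) ^ 2 + (Omg 1 3 w p) ^ 2 + (Omg 2 3 w p) ^ 2) +
    ((Lb 1 w p) ^ 2 + (Lb 2 w p) ^ 2 + (Lb 3 w p) ^ 2) + (Sc w p) ^ 2
  have hfd : Continuous fd := ((((hw.pow 2).add ((((hOmg 1 2).pow 2).add ((hOmg 1 3).pow 2)).add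
    ((hOmg 2 3).pow 2))).add ((((hLb 1).pow 2).add ((hLb 2).pow 2)).add ((hLb 3).pow 2))).add
      (hSc.pow 2)).continuous
  have hF : ∀ s, 0 ≤ s → s < T + 1 → Fen w s = IK R fd s := by
    intro s h0 h1
    symm
    exact IK_eq R s (f := fd) fun x hx => by
      simp [fd, Omg, Lb, Sc, zw s x h0 h1 hx, zd _ s x h0 h1 hx]
  have cmp1 : IK R fd T ≤ 9 * Y T + 2 * G T := by
    rw [hY, hG, ← IK_cmul, ← IK_cmul, ← IK_add R T (f := fun p => 9 * w p ^ 2) (g := fun p => 2 * qd w p) (continuous_const.mul (hwc.pow 2))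
      (continuous_const.mul hq.continuous)]
    refine IK_mono R T hfd ((continuous_const.mul (hwc.pow 2)).add
      (continuous_const.mul hq.continuous)) fun x => ?_
    simp only [fd, qd]
    have : ∀ u a b c d e f g : ℝ, u ^ 2 + (b ^ 2 + c ^ 2 + d ^ 2) + (e ^ 2 + f ^ 2 + g ^ 2) + a ^ 2
      ≤ 9 * u ^ 2 + 2 * ((a + 2 * u) ^ 2 + (b ^ 2 + c ^ 2 + d ^ 2)
        + (e ^ 2 + f ^ 2 + g ^ 2)) := fun u a b c d e f g => by
          nlinarith [sq_nonneg b, sq_nonneg c, sq_nonneg (a + 4 * u),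
          sq_nonneg d, sq_nonneg e, sq_nonneg f, sq_nonneg g]
    exact this _ _ _ _ _ _ _ _
  have cmp2 : G 0 ≤ 9 * IK R fd 0 := by
    rw [hG, ← IK_cmul]
    refine IK_mono R 0 hq.continuous (continuous_const.mul hfd) fun x => ?_
    simp only [fd, qd]
    have : ∀ u a b c d e f g : ℝ, (a + 2 * u) ^ 2 + (b ^ 2 + c ^ 2 + d ^ 2)
        + (e ^ 2 + f ^ 2 + g ^ 2) ≤ 9 * (u ^ 2 + (b ^ 2 + c ^ 2 + d ^ 2)
        + (e ^ 2 + f ^ 2 + g ^ 2) + a ^ 2) := fun u a b c d e f g => by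
          nlinarith [sq_nonneg b, sq_nonneg c, sq_nonneg (a - u), sq_nonneg a, sq_nonneg u,
          sq_nonneg d, sq_nonneg e, sq_nonneg f, sq_nonneg g]
    exact this _ _ _ _ _ _ _ _
  have cmp3 : Y 0 ≤ IK R fd 0 := by
    refine IK_mono R 0 (hwc.pow 2) hfd fun x => ?_
    simp only [fd]
    have : ∀ u a b c d e f g : ℝ, u ^ 2 ≤ u ^ 2 + (b ^ 2 + c ^ 2 + d ^ 2)
        + (e ^ 2 + f ^ 2 + g ^ 2) + a ^ 2 := fun u a b c d e f g => by
          nlinarith [sq_nonneg b, sq_nonneg c, sq_nonneg a,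
          sq_nonneg d, sq_nonneg e, sq_nonneg f, sq_nonneg g]
    exact this _ _ _ _ _ _ _ _
  have hIeq : ∫ τ in (0:ℝ)..T, L2norm (fun x => jb (τ + rnorm x) * Ψ (pt τ x)) = I := by
    refine intervalIntegral.integral_congr fun τ hτ => ?_
    rw [Set.uIcc_of_le hT] at hτ
    have hτ1 : τ < T + 1 := by linarith [hτ.2]
    simp only [L2norm, hB]
    rw [← Real.sqrt_eq_rpow, IK_eq R τ (fun x hx => by simp [g, zΨ τ x hτ.1 hτ1 hx])]
    congr 2
    funext x
    simp only [g, jb, mul_pow, sq_abs]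
    simp only [rnorm, Fin.sum_univ_three]
    rfl
  rw [hIeq, hF T hT (by linarith), hF 0 le_rfl hT1]
  set F0 := Real.sqrt (IK R fd 0) with hF0
  have b1 : Real.sqrt (IK R fd T) ≤ 3 * Real.sqrt (Y T) + 2 * Real.sqrt (G T) := by
    refine Real.sqrt_le_iff.2 ⟨by positivity, ?_⟩
    nlinarith [Real.sq_sqrt (hYn T), Real.sq_sqrt (hGn T),
      mul_nonneg (Real.sqrt_nonneg (Y T)) (Real.sqrt_nonneg (G T)), hGn T]
  have b2 : Real.sqrt (G 0) ≤ 3 * F0 := by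
    refine (Real.sqrt_le_sqrt cmp2).trans_eq ?_
    rw [Real.sqrt_mul (by norm_num), show (9:ℝ) = 3 ^ 2 by norm_num, Real.sqrt_sq (by norm_num)]
  have b3 : Real.sqrt (Y 0) ≤ F0 := Real.sqrt_le_sqrt cmp3
  have b4 := hGA T ⟨hT, le_rfl⟩
  have hF00 : 0 ≤ F0 := Real.sqrt_nonneg _
  linarith

/-- conformal energy estimate for the 3D wave equation. -/
theorem stmt_15 :
    ∃ C : ℝ, 0 < C ∧ ∀ w Ψ : Pt → ℝ, ContDiff ℝ (⊤ : ℕ∞) w →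
      (∀ T : ℝ, ∃ R : ℝ, ∀ (t : ℝ) (x : Sp), 0 ≤ t → t ≤ T → R ≤ rnorm x → w (pt t x) = 0) →
      (∀ p : Pt, box w p = Ψ p) →
      ∀ (t : ℝ), 0 ≤ t →
        Real.sqrt (Fen w t) ≤ C * (Real.sqrt (Fen w 0) +
          ∫ τ in (0:ℝ)..t, L2norm (fun x => jb (τ + rnorm x) * Ψ (pt τ x))) := by
  exact ⟨27, by norm_num, fun w Ψ hw hs hΨ t ht => main_est w Ψ hw hs hΨ t ht⟩
end
end

section
/- (Ghost weight estimate for the 3D Klein–Gordon equation) Let w:[0,∞)×ℝ³→ℝ be smooth, with w(t,·) compactly supported in x uniformly for t in compact intervals, and suppose ∂_t²w − Δw + w = f. Define E_gst(t,w) = ∫_{ℝ³} ( |∂_t w|² + Σ_{a=1}³ |∂_a w|² + w² )(t,x) dx + ∫₀^t ∫_{ℝ³} w(τ,x)² ⟨r−τ⟩^{-9/8} dx dτ + Σ_{a=1}³ ∫₀^t ∫_{ℝ³} |G_a w(τ,x)|² ⟨r−τ⟩^{-9/8} dx dτ. Then there is a universal constant C>0 such that for all t≥0: E_gst(t,w)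 ≤ C ( ∫_{ℝ³} ( |∂_t w|² + Σ_{a=1}³ |∂_a w|² + w² )(0,x) dx + ∫₀^t ∫_{ℝ³} |f(τ,x) ∂_t w(τ,x)| dx dτ ). -/
open MeasureTheory Real

noncomputable section

/-- Klein–Gordon energy of w at time t. -/
def KGen (w : Pt → ℝ) (t : ℝ) : ℝ :=
  ∫ x : Sp, ((pd 0 w (pt t x)) ^ 2 + ∑ a : Fin 3, (pd a.succ w (pt t x)) ^ 2 +
    (w (pt t x)) ^ 2)

/-- Ghost weight energy of w at time t. -/
def Egst (w : Pt → ℝ) (t : ℝ) : ℝ :=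
  KGen w t +
  (∫ τ in (0:ℝ)..t, ∫ x : Sp, (w (pt τ x)) ^ 2 * (jb (rnorm x - τ)) ^ (-(9/8) : ℝ)) +
  ∑ a : Fin 3, ∫ τ in (0:ℝ)..t, ∫ x : Sp,
    (Ga a w (pt τ x)) ^ 2 * (jb (rnorm x - τ)) ^ (-(9/8) : ℝ)

namespace Ghost

def W' (s : ℝ) : ℝ := (jb s) ^ (-(9/8) : ℝ)

def M : ℝ := ∫ s : ℝ, W' s

def W (s : ℝ) : ℝ := M + 1 + ∫ σ in (0:ℝ)..s, W' σ

lemma jb_pos (s : ℝ) : 0 < jb s := Real.sqrt_pos.2 (by positivity)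

lemma W'_pos (s : ℝ) : 0 < W' s := Real.rpow_pos_of_pos (jb_pos s) _

lemma W'_cont : Continuous W' := by
  unfold W'
  refine Continuous.rpow_const ?_ (fun s => Or.inl (jb_pos s).ne')
  unfold jb
  fun_prop

lemma W'_int : Integrable W' := by
  have h := integrable_rpow_neg_one_add_norm_sq (E := ℝ) (μ := volume) (r := 9/8) (by norm_num)
  refine h.congr (Filter.Eventually.of_forall fun s => ?_)
  simp only [W', jb, Real.sqrt_eq_rpow, Real.norm_eq_abs, sq_abs]
  rw [← Real.rpow_mul (by positivity)]
  norm_num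

lemma M_nonneg : 0 ≤ M := integral_nonneg fun s => (W'_pos s).le

lemma W_aux (s : ℝ) : |∫ σ in (0:ℝ)..s, W' σ| ≤ M := by
  have h := intervalIntegral.norm_integral_le_integral_norm_uIoc (f := W') (a := 0) (b := s)
    (μ := volume)
  rw [Real.norm_eq_abs] at h
  refine h.trans ?_
  have : (∫ x in Set.uIoc 0 s, ‖W' x‖) = ∫ x in Set.uIoc 0 s, W' x := by
    refine integral_congr_ae (Filter.Eventually.of_forall fun x => ?_)
    simp [abs_of_pos (W'_pos x)]
  rw [this]
  exact setIntegral_le_integral W'_int (Filter.Eventually.of_forall fun x => (W'_pos x).le)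

lemma W_ge (s : ℝ) : 1 ≤ W s := by
  have := abs_le.1 (W_aux s)
  unfold W; linarith

lemma W_le (s : ℝ) : W s ≤ 1 + 2 * M := by
  have := abs_le.1 (W_aux s)
  unfold W; linarith

lemma W_deriv (s : ℝ) : HasDerivAt W (W' s) s := by
  unfold W
  refine HasDerivAt.const_add _ ?_
  exact intervalIntegral.integral_hasDerivAt_right (W'_cont.intervalIntegrable _ _)
    W'_cont.stronglyMeasurable.stronglyMeasurableAtFilter W'_cont.continuousAt

lemma W_cont : Continuous W := continuous_iff_continuousAt.2 fun s => (W_deriv s).continuousAt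

lemma rnorm_cont : Continuous rnorm := by unfold rnorm; fun_prop

lemma abs_le_rnorm (x : Sp) (i : Fin 3) : |x i| ≤ rnorm x := by
  unfold rnorm
  refine Real.abs_le_sqrt ?_
  exact Finset.single_le_sum (f := fun a => x a ^ 2) (fun a _ => sq_nonneg _) (Finset.mem_univ i)

lemma rnorm_ne {x : Sp} (hx : x ≠ 0) : rnorm x ≠ 0 := by
  intro h
  apply hx
  ext i
  have := abs_le_rnorm x i
  rw [h] at this
  simpa using this

lemma rnorm_sq (x : Sp) : rnorm x ^ 2 = ∑ a, x a ^ 2 :=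
  Real.sq_sqrt (Finset.sum_nonneg fun _ _ => sq_nonneg _)

/-- radial unit vector -/
def om (a : Fin 3) (x : Sp) : ℝ := x a / rnorm x

lemma om_le (a : Fin 3) (x : Sp) : |om a x| ≤ 1 := by
  unfold om
  rw [abs_div]
  refine div_le_one_of_le₀ ?_ (abs_nonneg _)
  exact (abs_le_rnorm x a).trans (le_abs_self _)

lemma om_meas (a : Fin 3) : Measurable (om a) := by
  unfold om
  exact (measurable_pi_apply a).div rnorm_cont.measurable

lemma om_sq {x : Sp} (hx : x ≠ 0) : om 0 x ^ 2 + om 1 x ^ 2 + om 2 x ^ 2 = 1 := by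
  have h := rnorm_sq x
  have h0 := rnorm_ne hx
  rw [Fin.sum_univ_three] at h
  unfold om
  field_simp
  linarith

def drn (x : Sp) : Sp →L[ℝ] ℝ := ∑ a, om a x • ContinuousLinearMap.proj (R := ℝ) (φ := fun _ : Fin 3 => ℝ) a

lemma rnorm_deriv {x : Sp} (hx : x ≠ 0) : HasFDerivAt rnorm (drn x) x := by
  have h1 : HasFDerivAt (fun y : Sp => ∑ a, y a ^ 2)
      (∑ a, (2 * x a) • ContinuousLinearMap.proj (R := ℝ) (φ := fun _ : Fin 3 => ℝ) a) x := by
    refine HasFDerivAt.fun_sum fun a _ => ?_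
    have := (hasFDerivAt_apply (𝕜 := ℝ) (F' := fun _ : Fin 3 => ℝ) a x).pow 2
    simpa using this
  have h0 : (∑ a, x a ^ 2) ≠ 0 := by
    rw [← rnorm_sq]; exact pow_ne_zero _ (rnorm_ne hx)
  have h2 := h1.sqrt h0
  refine h2.congr_fderiv ?_
  have h3 := rnorm_ne hx
  ext v
  simp only [drn, om, _root_.smul_apply, _root_.sum_apply, smul_eq_mul,
    ContinuousLinearMap.proj_apply, Finset.mul_sum]
  refine Finset.sum_congr rfl fun a _ => ?_
  change 1 / (2 * rnorm x) * _ = _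
  field_simp

lemma drn_single (x : Sp) (a : Fin 3) : drn x (Pi.single a 1) = om a x := by
  simp [drn, Pi.single_apply]

/-- divergence theorem -/
lemma div_zero (F : Fin 3 → Sp → ℝ) (F' : Fin 3 → Sp → Sp →L[ℝ] ℝ) (R : ℝ) (hR : 0 ≤ R)
    (hc : ∀ i, Continuous (F i)) (hd : ∀ x ≠ 0, ∀ i, HasFDerivAt (F i) (F' i x) x)
    (h0 : ∀ i x, R < rnorm x → F i x = 0)
    (hD0 : ∀ x, R < rnorm x → ∑ i, F' i x (Pi.single i 1) = 0)
    (hi : Integrable (fun x => ∑ i, F' i x (Pi.single i 1))) :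
    ∫ x, ∑ i, F' i x (Pi.single i 1) = 0 := by
  have key := integral_divergence_of_hasFDerivAt_off_countable' (n := 2)
    (fun _ => -(R+1)) (fun _ => R+1) (fun i => by simp only; linarith) F F' {0}
    (Set.countable_singleton _) (fun i => (hc i).continuousOn)
    (fun x hx i => hd x (by simpa using hx.2) i) hi.integrableOn
  have hout : ∀ (i : Fin 3) (x : Sp), R + 1 ≤ |x i| → R < rnorm x := fun i x h => by
    have := abs_le_rnorm x i
    linarith
  rw [setIntegral_eq_integral_of_forall_compl_eq_zero] at key
  · rw [key]
    refine Finset.sum_eq_zero fun i _ => ?_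
    have e1 : ∀ y : Fin 2 → ℝ, F i (i.insertNth (R+1) y) = 0 := fun y => by
      apply h0 i _ (hout i _ _)
      rw [Fin.insertNth_apply_same]
      exact le_abs_self _
    have e2 : ∀ y : Fin 2 → ℝ, F i (i.insertNth (-(R+1)) y) = 0 := fun y => by
      apply h0 i _ (hout i _ _)
      rw [Fin.insertNth_apply_same, abs_neg]
      exact le_abs_self _
    simp only [e1, e2]
    simp
  · intro x hx
    apply hD0
    by_contra hcon
    apply hx
    rw [Set.mem_Icc, Pi.le_def, Pi.le_def]
    constructor <;> intro i <;>
    · have := abs_le.1 ((abs_le_rnorm x i).trans (not_lt.1 hcon))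
      linarith [this.1, this.2]

lemma pt_cont : Continuous (fun z : ℝ × Sp => pt z.1 z.2) := by
  unfold pt
  exact Continuous.finCons continuous_fst continuous_snd

@[fun_prop]
lemma pt_cont' {X : Type*} [TopologicalSpace X] {g : X → ℝ} {h : X → Sp} (hg : Continuous g)
    (hh : Continuous h) : Continuous (fun y => pt (g y) (h y)) :=
  pt_cont.comp (hg.prodMk hh)

def Lx : Sp →L[ℝ] Pt := ContinuousLinearMap.pi
  (Fin.cons 0 (fun a => ContinuousLinearMap.proj (R := ℝ) (φ := fun _ : Fin 3 => ℝ) a))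

lemma Lx_single (a : Fin 3) : Lx (Pi.single a 1) = Pi.single a.succ 1 := by
  ext i
  refine Fin.cases ?_ (fun j => ?_) i
  · simp [Lx]
  · simp [Lx, Pi.single_apply]

lemma pt_deriv_x (τ : ℝ) (x : Sp) : HasFDerivAt (fun y => pt τ y) Lx x := by
  have : (fun y => pt τ y) = fun y => pt τ 0 + Lx y := by
    ext y i
    refine Fin.cases ?_ (fun j => ?_) i
    · simp [Lx, pt]
    · simp [Lx, pt]
  rw [this]
  exact Lx.hasFDerivAt.const_add _

lemma pt_deriv_t (τ : ℝ) (x : Sp) : HasDerivAt (fun s => pt s x) (Pi.single 0 1 : Pt) τ := by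
  rw [hasDerivAt_pi]
  intro i
  refine Fin.cases ?_ (fun j => ?_) i
  · simpa [pt] using hasDerivAt_id' τ
  · simpa [pt] using hasDerivAt_const τ (x j)

abbrev Sm (u : Pt → ℝ) : Prop := ContDiff ℝ (⊤ : ℕ∞) u

lemma Sm.pd {u : Pt → ℝ} (h : Sm u) (i : Fin 4) : Sm (pd i u) := by
  have := h.fderiv_right (m := ((⊤ : ℕ∞) : WithTop ℕ∞)) (by simp)
  exact this.clm_apply contDiff_const

lemma Sm.diff {u : Pt → ℝ} (h : Sm u) (p : Pt) : HasFDerivAt u (fderiv ℝ u p) p :=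
  (h.differentiable (by simp) p).hasFDerivAt

lemma Sm.cont {u : Pt → ℝ} (h : Sm u) : Continuous (fun z : ℝ × Sp => u (pt z.1 z.2)) :=
  h.continuous.comp pt_cont

lemma Sm.dt {u : Pt → ℝ} (h : Sm u) (τ : ℝ) (x : Sp) :
    HasDerivAt (fun s => u (pt s x)) (_root_.pd 0 u (pt τ x)) τ :=
  (h.diff _).comp_hasDerivAt τ (pt_deriv_t τ x)

lemma Sm.dx {u : Pt → ℝ} (h : Sm u) (τ : ℝ) (x : Sp) :
    HasFDerivAt (fun y => u (pt τ y)) ((fderiv ℝ u (pt τ x)).comp Lx) x :=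
  (h.diff _).comp x (pt_deriv_x τ x)

lemma pd_comm {u : Pt → ℝ} (h : Sm u) (i j : Fin 4) (p : Pt) :
    pd i (pd j u) p = pd j (pd i u) p := by
  have hs : IsSymmSndFDerivAt ℝ u p :=
    (h.contDiffAt).isSymmSndFDerivAt (by simp; exact WithTop.coe_le_coe.2 le_top)
  have hd : DifferentiableAt ℝ (fderiv ℝ u) p :=
    (h.fderiv_right (m := ((⊤ : ℕ∞) : WithTop ℕ∞)) (by simp)).differentiable (by simp) p
  have key : ∀ v w : Pt, fderiv ℝ (fun q => fderiv ℝ u q v) p w = fderiv ℝ (fderiv ℝ u) p w v := by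
    intro v w
    rw [fderiv_clm_apply hd (by fun_prop)]
    simp
  unfold pd
  rw [key, key]
  exact hs _ _

/-- vanishing outside a ball for times in `[0,T]` -/
def Van (T R : ℝ) (u : Pt → ℝ) : Prop :=
  ∀ (t : ℝ) (x : Sp), 0 ≤ t → t ≤ T → R < rnorm x → u (pt t x) = 0

lemma Van.pd {T R : ℝ} (hT : 0 < T) {u : Pt → ℝ} (hu : Sm u) (h : Van T R u) (i : Fin 4) :
    Van T R (pd i u) := by
  intro t x h0 h1 hx
  have hopen : ∀ s ∈ Set.Ioo 0 T, _root_.pd i u (pt s x) = 0 := by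
    intro s hs
    have hev : u =ᶠ[nhds (pt s x)] fun _ => 0 := by
      have c0 : Continuous fun p : Pt => p 0 := continuous_apply 0
      have c1 : Continuous fun p : Pt => rnorm (fun a => p a.succ) :=
        rnorm_cont.comp (by fun_prop)
      have a1 := c0.continuousAt.eventually_mem
        (isOpen_Ioo.mem_nhds (show (pt s x) 0 ∈ Set.Ioo 0 T by simpa [pt] using hs))
      have a2 := c1.continuousAt.eventually_mem (x := pt s x) (s := Set.Ioi R)
        (isOpen_Ioi.mem_nhds (by simpa [pt] using hx))
      filter_upwards [a1, a2] with p hp1 hp2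
      have := h (p 0) (fun a => p a.succ) hp1.1.le hp1.2.le hp2
      have e : pt (p 0) (fun a => p a.succ) = p := Fin.cons_self_tail p
      rwa [e] at this
    unfold _root_.pd
    rw [hev.fderiv_eq]
    simp
  have hcl : Set.EqOn (fun s => _root_.pd i u (pt s x)) (fun _ => 0) (closure (Set.Ioo 0 T)) :=
    Set.EqOn.closure hopen ((hu.pd i).cont.comp (by fun_prop : Continuous fun s : ℝ => (s, x)))
      continuous_const
  rw [closure_Ioo hT.ne] at hcl
  exact hcl ⟨h0, h1⟩

lemma compact_ball (R : ℝ) : ∃ K : Set Sp, IsCompact K ∧ ∀ x, x ∉ K → R < rnorm x := by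
  refine ⟨Set.Icc (fun _ => -R) (fun _ => R), isCompact_Icc, fun x hx => ?_⟩
  by_contra hcon
  apply hx
  rw [Set.mem_Icc, Pi.le_def, Pi.le_def]
  constructor <;> intro i <;>
  · have := abs_le.1 ((abs_le_rnorm x i).trans (not_lt.1 hcon))
    first | exact this.1 | exact this.2

lemma int_x (g : Sp → ℝ) (R : ℝ) (hg : Continuous g) (h : ∀ x, R < rnorm x → g x = 0) :
    Integrable g := by
  obtain ⟨K, hK, hK'⟩ := compact_ball R
  exact hg.integrable_of_hasCompactSupport (HasCompactSupport.intro hK fun x hx => h x (hK' x hx))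

lemma int_tx (g : ℝ × Sp → ℝ) (t R : ℝ) (hg : Continuous g)
    (h : ∀ τ x, 0 ≤ τ → τ ≤ t → R < rnorm x → g (τ, x) = 0) :
    Integrable g ((volume.restrict (Set.Ioc 0 t)).prod volume) := by
  obtain ⟨K, hK, hK'⟩ := compact_ball R
  have h1 : IntegrableOn g (Set.Icc 0 t ×ˢ K) (volume.prod volume) :=
    hg.continuousOn.integrableOn_compact (isCompact_Icc.prod hK)
  have h2 : IntegrableOn g (Set.Ioc 0 t ×ˢ Set.univ) (volume.prod volume) := by
    refine h1.of_forall_sdiff_eq_zero (measurableSet_Ioc.prod MeasurableSet.univ) ?_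
    rintro ⟨τ, x⟩ ⟨⟨hτ, _⟩, hn⟩
    refine h τ x hτ.1.le hτ.2 (hK' x fun hx => hn ⟨⟨hτ.1.le, hτ.2⟩, hx⟩)
  rw [IntegrableOn, ← Measure.prod_restrict, Measure.restrict_univ] at h2
  exact h2

lemma ii_of {t : ℝ} (ht : 0 ≤ t) {g : ℝ × Sp → ℝ}
    (h : Integrable g ((volume.restrict (Set.Ioc 0 t)).prod volume)) :
    IntervalIntegrable (fun τ => ∫ x, g (τ, x)) volume 0 t := by
  rw [intervalIntegrable_iff_integrableOn_Ioc_of_le ht]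
  exact h.integral_prod_left

lemma swap {t : ℝ} (ht : 0 ≤ t) {g : ℝ × Sp → ℝ}
    (h : Integrable g ((volume.restrict (Set.Ioc 0 t)).prod volume)) :
    ∫ τ in (0:ℝ)..t, ∫ x, g (τ, x) = ∫ x, ∫ τ in (0:ℝ)..t, g (τ, x) := by
  simp only [intervalIntegral.integral_of_le ht]
  exact integral_integral_swap (f := fun τ x => g (τ, x)) h


def en (w : Pt → ℝ) (z : ℝ × Sp) : ℝ :=
  (pd 0 w (pt z.1 z.2)) ^ 2 + ∑ a : Fin 3, (pd a.succ w (pt z.1 z.2)) ^ 2 + (w (pt z.1 z.2)) ^ 2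

def wt (z : ℝ × Sp) : ℝ := W (rnorm z.2 - z.1)

def wp (z : ℝ × Sp) : ℝ := W' (rnorm z.2 - z.1)

lemma wt_cont : Continuous wt :=
  W_cont.comp ((rnorm_cont.comp continuous_snd).sub continuous_fst)

lemma wp_cont : Continuous wp :=
  W'_cont.comp ((rnorm_cont.comp continuous_snd).sub continuous_fst)

def HH (w : Pt → ℝ) (z : ℝ × Sp) : ℝ :=
  -wp z * en w z + wt z * (2 * pd 0 w (pt z.1 z.2) * pd 0 (pd 0 w) (pt z.1 z.2)
    + ∑ a : Fin 3, 2 * pd a.succ w (pt z.1 z.2) * pd 0 (pd a.succ w) (pt z.1 z.2)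
    + 2 * w (pt z.1 z.2) * pd 0 w (pt z.1 z.2))

def PP (w f : Pt → ℝ) (z : ℝ × Sp) : ℝ :=
  2 * (wt z * (f (pt z.1 z.2) * pd 0 w (pt z.1 z.2)))

def QQ (w : Pt → ℝ) (z : ℝ × Sp) : ℝ := w (pt z.1 z.2) ^ 2 * wp z

def QG (w : Pt → ℝ) (a : Fin 3) (z : ℝ × Sp) : ℝ := (Ga a w (pt z.1 z.2)) ^ 2 * wp z

def QB (w : Pt → ℝ) (a : Fin 3) (z : ℝ × Sp) : ℝ :=
  2 * ((pd 0 w (pt z.1 z.2)) ^ 2 + (pd a.succ w (pt z.1 z.2)) ^ 2) * wp z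

lemma Ga_eq (a : Fin 3) (w : Pt → ℝ) (τ : ℝ) (x : Sp) :
    Ga a w (pt τ x) = om a x * pd 0 w (pt τ x) + pd a.succ w (pt τ x) := by
  unfold Ga om rnorm
  rw [Fin.sum_univ_three]
  rfl

lemma en_cont {w : Pt → ℝ} (hw : Sm w) : Continuous (en w) := by
  unfold en
  have h0 := (hw.pd 0).cont
  have h := fun a : Fin 3 => (hw.pd a.succ).cont
  have h1 := hw.continuous
  fun_prop

lemma HH_cont {w : Pt → ℝ} (hw : Sm w) : Continuous (HH w) := by
  unfold HH
  have h0 := (hw.pd 0).cont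
  have h00 := ((hw.pd 0).pd 0).cont
  have h := fun a : Fin 3 => (hw.pd a.succ).cont
  have h' := fun a : Fin 3 => ((hw.pd a.succ).pd 0).cont
  have h1 := hw.continuous
  have h2 := en_cont hw
  have h3 := wt_cont
  have h4 := wp_cont
  fun_prop

lemma QQ_cont {w : Pt → ℝ} (hw : Sm w) : Continuous (QQ w) := by
  unfold QQ
  have h1 := hw.continuous
  have h4 := wp_cont
  fun_prop

lemma QB_cont {w : Pt → ℝ} (hw : Sm w) (a : Fin 3) : Continuous (QB w a) := by
  unfold QB
  have h0 := (hw.pd 0).cont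
  have h := (hw.pd a.succ).cont
  have h4 := wp_cont
  fun_prop

lemma QG_meas {w : Pt → ℝ} (hw : Sm w) (a : Fin 3) : Measurable (QG w a) := by
  unfold QG
  simp only [Ga_eq]
  have h0 := (hw.pd 0).cont.measurable
  have h := (hw.pd a.succ).cont.measurable
  have h4 := wp_cont.measurable
  have h5 : Measurable fun z : ℝ × Sp => om a z.2 := (om_meas a).comp measurable_snd
  fun_prop

lemma QG_nonneg (w : Pt → ℝ) (a : Fin 3) (z) : 0 ≤ QG w a z :=
  mul_nonneg (sq_nonneg _) (W'_pos _).le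

lemma QG_le (w : Pt → ℝ) (a : Fin 3) (z) : ‖QG w a z‖ ≤ QB w a z := by
  rw [Real.norm_eq_abs, abs_of_nonneg (QG_nonneg w a z)]
  unfold QG QB
  refine mul_le_mul_of_nonneg_right ?_ (W'_pos _).le
  rw [Ga_eq]
  have h1 := (sq_le_one_iff_abs_le_one _).2 (om_le a z.2)
  have h2 := mul_le_mul_of_nonneg_right h1 (sq_nonneg (pd 0 w (pt z.1 z.2)))
  nlinarith [sq_nonneg (om a z.2 * pd 0 w (pt z.1 z.2) - pd a.succ w (pt z.1 z.2))]

section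
variable {w f : Pt → ℝ} {t R : ℝ}

lemma f_sm (hw : Sm w) (hf : ∀ p : Pt, box w p + w p = f p) : Sm f := by
  have : f = fun p => box w p + w p := funext fun p => (hf p).symm
  rw [this]
  unfold box
  exact ((((hw.pd 0).pd 0)).sub ((((hw.pd 1).pd 1).add ((hw.pd 2).pd 2)).add ((hw.pd 3).pd 3))).add hw

lemma PP_cont (hw : Sm w) (hf : ∀ p : Pt, box w p + w p = f p) : Continuous (PP w f) := by
  unfold PP
  have h0 := (hw.pd 0).cont
  have h := (f_sm hw hf).continuous
  have h4 := wt_cont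
  fun_prop

lemma v1 (ht : 0 ≤ t) (hw : Sm w) (hv : Van (t+1) R w) (i : Fin 4) (τ : ℝ) (x : Sp) (h0 : 0 ≤ τ) (h1 : τ ≤ t) (hx : R < rnorm x) :
    pd i w (pt τ x) = 0 :=
  (hv.pd (by linarith) hw i) τ x h0 (by linarith) hx

lemma v2 (ht : 0 ≤ t) (hw : Sm w) (hv : Van (t+1) R w) (i j : Fin 4) (τ : ℝ) (x : Sp) (h0 : 0 ≤ τ) (h1 : τ ≤ t) (hx : R < rnorm x) :
    pd i (pd j w) (pt τ x) = 0 :=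
  ((hv.pd (by linarith) hw j).pd (by linarith) (hw.pd j) i) τ x h0 (by linarith) hx

lemma v0 (hv : Van (t+1) R w) (τ : ℝ) (x : Sp) (h0 : 0 ≤ τ) (h1 : τ ≤ t) (hx : R < rnorm x) :
    w (pt τ x) = 0 := hv τ x h0 (by linarith) hx

lemma en_v (ht : 0 ≤ t) (hw : Sm w) (hv : Van (t+1) R w) (τ : ℝ) (x : Sp) (h0 : 0 ≤ τ) (h1 : τ ≤ t) (hx : R < rnorm x) : en w (τ, x) = 0 := by
  simp [en, v1 ht hw hv _ τ x h0 h1 hx, v0 hv τ x h0 h1 hx]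

lemma HH_v (ht : 0 ≤ t) (hw : Sm w) (hv : Van (t+1) R w) (τ : ℝ) (x : Sp) (h0 : 0 ≤ τ) (h1 : τ ≤ t) (hx : R < rnorm x) : HH w (τ, x) = 0 := by
  simp [HH, en, v1 ht hw hv _ τ x h0 h1 hx, v0 hv τ x h0 h1 hx]

lemma PP_v (ht : 0 ≤ t) (hw : Sm w) (hv : Van (t+1) R w) (τ : ℝ) (x : Sp) (h0 : 0 ≤ τ) (h1 : τ ≤ t) (hx : R < rnorm x) : PP w f (τ, x) = 0 := by
  simp [PP, v1 ht hw hv _ τ x h0 h1 hx]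

lemma QQ_v (hv : Van (t+1) R w) (τ : ℝ) (x : Sp) (h0 : 0 ≤ τ) (h1 : τ ≤ t) (hx : R < rnorm x) : QQ w (τ, x) = 0 := by
  simp [QQ, v0 hv τ x h0 h1 hx]

lemma QB_v (ht : 0 ≤ t) (hw : Sm w) (hv : Van (t+1) R w) (a : Fin 3) (τ : ℝ) (x : Sp) (h0 : 0 ≤ τ) (h1 : τ ≤ t) (hx : R < rnorm x) :
    QB w a (τ, x) = 0 := by
  simp [QB, v1 ht hw hv _ τ x h0 h1 hx]

lemma QG_int_x (ht : 0 ≤ t) (hw : Sm w) (hv : Van (t+1) R w) (a : Fin 3) (τ : ℝ) (h0 : 0 ≤ τ) (h1 : τ ≤ t) :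
    Integrable (fun x => QG w a (τ, x)) := by
  refine (int_x (fun x => QB w a (τ, x)) R ((QB_cont hw a).comp (by fun_prop))
    fun x hx => QB_v ht hw hv a τ x h0 h1 hx).mono' ?_ (Filter.Eventually.of_forall fun x => QG_le w a _)
  exact ((QG_meas hw a).comp (by fun_prop)).aestronglyMeasurable

lemma QG_int_tx (ht : 0 ≤ t) (hw : Sm w) (hv : Van (t+1) R w) (a : Fin 3) :
    Integrable (QG w a) ((volume.restrict (Set.Ioc 0 t)).prod volume) :=
  (int_tx (QB w a) t R (QB_cont hw a)
    fun τ x h0 h1 hx => QB_v ht hw hv a τ x h0 h1 hx).mono' (QG_meas hw a).aestronglyMeasurable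
    (Filter.Eventually.of_forall fun _ => QG_le w a _)

/-- pointwise time derivative -/
lemma en_dt (hw : Sm w) (τ : ℝ) (x : Sp) :
    HasDerivAt (fun s => wt (s, x) * en w (s, x)) (HH w (τ, x)) τ := by
  have h1 : HasDerivAt (fun s => wt (s, x)) (-wp (τ, x)) τ := by
    have := (W_deriv (rnorm x - τ)).comp τ ((hasDerivAt_id' τ).const_sub (rnorm x))
    simpa [wt, wp, Function.comp_def] using this
  have h2 : HasDerivAt (fun s => en w (s, x)) (2 * pd 0 w (pt τ x) * pd 0 (pd 0 w) (pt τ x)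
    + ∑ a : Fin 3, 2 * pd a.succ w (pt τ x) * pd 0 (pd a.succ w) (pt τ x)
    + 2 * w (pt τ x) * pd 0 w (pt τ x)) τ := by
    unfold en
    refine HasDerivAt.fun_add (HasDerivAt.fun_add ?_ (HasDerivAt.fun_sum fun a _ => ?_)) ?_
    · simpa using ((hw.pd 0).dt τ x).fun_pow 2
    · simpa using ((hw.pd a.succ).dt τ x).fun_pow 2
    · simpa using (hw.dt τ x).fun_pow 2
  exact h1.mul h2

def FF (w : Pt → ℝ) (τ : ℝ) (a : Fin 3) (x : Sp) : ℝ :=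
  2 * (wt (τ, x) * (pd 0 w (pt τ x) * pd a.succ w (pt τ x)))

def FF' (w : Pt → ℝ) (τ : ℝ) (a : Fin 3) (x : Sp) : Sp →L[ℝ] ℝ :=
  (2:ℝ) • (wt (τ, x) • (pd 0 w (pt τ x) • (fderiv ℝ (pd a.succ w) (pt τ x)).comp Lx
      + pd a.succ w (pt τ x) • (fderiv ℝ (pd 0 w) (pt τ x)).comp Lx)
    + (pd 0 w (pt τ x) * pd a.succ w (pt τ x)) • (wp (τ, x) • drn x))

lemma FF_deriv (hw : Sm w) (τ : ℝ) (a : Fin 3) (x : Sp) (hx : x ≠ 0) :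
    HasFDerivAt (FF w τ a) (FF' w τ a x) x := by
  have h1 : HasFDerivAt (fun y => wt (τ, y)) (wp (τ, x) • drn x) x := by
    exact (W_deriv (rnorm x - τ)).comp_hasFDerivAt x ((rnorm_deriv hx).sub_const τ)
  exact (h1.mul (((hw.pd 0).dx τ x).mul ((hw.pd a.succ).dx τ x))).const_mul 2

lemma FF'_single (w : Pt → ℝ) (τ : ℝ) (a : Fin 3) (x : Sp) :
    FF' w τ a x (Pi.single a 1) = 2 * (wt (τ, x) * (pd 0 w (pt τ x) * pd a.succ (pd a.succ w) (pt τ x)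
      + pd a.succ w (pt τ x) * pd a.succ (pd 0 w) (pt τ x))
      + (pd 0 w (pt τ x) * pd a.succ w (pt τ x)) * (wp (τ, x) * om a x)) := by
  simp only [FF', _root_.smul_apply, _root_.add_apply, smul_eq_mul, ContinuousLinearMap.comp_apply,
    drn_single, Lx_single]
  rfl

lemma ptwise (hw : Sm w) (hf : ∀ p : Pt, box w p + w p = f p) (τ : ℝ) (x : Sp) (hx : x ≠ 0) :
    ∑ a, FF' w τ a x (Pi.single a 1) =
      HH w (τ, x) - PP w f (τ, x) + QQ w (τ, x) + ∑ a, QG w a (τ, x) := by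
  simp only [FF'_single, HH, PP, QQ, QG, Ga_eq, en, ← hf, box, Fin.sum_univ_three]
  simp only [pd_comm hw 0]
  have h := om_sq hx
  have e1 : Fin.succ (0 : Fin 3) = 1 := rfl
  have e2 : Fin.succ (1 : Fin 3) = 2 := rfl
  have e3 : Fin.succ (2 : Fin 3) = 3 := rfl
  simp only [e1, e2, e3]
  linear_combination (-(wp (τ, x) * pd 0 w (pt τ x) ^ 2)) * h

lemma slice (ht : 0 ≤ t) (hR : 0 ≤ R) (hw : Sm w) (hv : Van (t+1) R w) (hf : ∀ p : Pt, box w p + w p = f p) (τ : ℝ) (h0 : 0 ≤ τ) (h1 : τ ≤ t) :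
    ∫ x, HH w (τ, x) = (∫ x, PP w f (τ, x)) - (∫ x, QQ w (τ, x)) - ∑ a, ∫ x, QG w a (τ, x) := by
  have cp : Continuous fun x : Sp => (τ, x) := by fun_prop
  have iH := int_x (fun x => HH w (τ, x)) R ((HH_cont hw).comp cp)
    fun x hx => HH_v ht hw hv τ x h0 h1 hx
  have iP := int_x (fun x => PP w f (τ, x)) R ((PP_cont hw hf).comp cp)
    fun x hx => PP_v ht hw hv τ x h0 h1 hx
  have iQ := int_x (fun x => QQ w (τ, x)) R ((QQ_cont hw).comp cp)
    fun x hx => QQ_v hv τ x h0 h1 hx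
  have iG := fun a => QG_int_x ht hw hv a τ h0 h1
  have iS : Integrable (fun x => ∑ a, QG w a (τ, x)) := integrable_finsetSum _ fun a _ => iG a
  have hae : (fun x => ∑ a, FF' w τ a x (Pi.single a 1)) =ᵐ[volume] fun x =>
      HH w (τ, x) - PP w f (τ, x) + QQ w (τ, x) + ∑ a, QG w a (τ, x) := by
    have : ∀ᵐ x : Sp, x ≠ 0 := by simp [ae_iff]
    filter_upwards [this] with x hx using ptwise hw hf τ x hx
  have iD := (((iH.sub iP).add iQ).add iS).congr hae.symm
  have hz := div_zero (FF w τ) (FF' w τ) R hR (fun a => by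
      unfold FF
      have c0 := (hw.pd 0).cont.comp cp
      have c1 := (hw.pd a.succ).cont.comp cp
      have c2 := wt_cont.comp cp
      exact continuous_const.mul (c2.mul (c0.mul c1)))
    (fun x hx a => FF_deriv hw τ a x hx)
    (fun a x hx => by simp [FF, v1 ht hw hv _ τ x h0 h1 hx])
    (fun x hx => by simp [FF'_single, v1 ht hw hv _ τ x h0 h1 hx])
    iD
  have i1 : Integrable fun x => HH w (τ, x) - PP w f (τ, x) := iH.sub iP
  have i2 : Integrable fun x => HH w (τ, x) - PP w f (τ, x) + QQ w (τ, x) := i1.add iQ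
  rw [integral_congr_ae hae, integral_add i2 iS, integral_add i1 iQ,
    integral_sub iH iP, integral_finsetSum _ fun a _ => iG a] at hz
  linarith

lemma main (ht : 0 ≤ t) (hR : 0 ≤ R) (hw : Sm w) (hv : Van (t+1) R w) (hf : ∀ p : Pt, box w p + w p = f p) : (∫ x, wt (t, x) * en w (t, x)) + (∫ τ in (0:ℝ)..t, ∫ x, QQ w (τ, x)) +
    (∑ a, ∫ τ in (0:ℝ)..t, ∫ x, QG w a (τ, x)) =
    (∫ x, wt (0, x) * en w (0, x)) + ∫ τ in (0:ℝ)..t, ∫ x, PP w f (τ, x) := by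
  have jH := int_tx (HH w) t R (HH_cont hw) fun τ x h0 h1 hx => HH_v ht hw hv τ x h0 h1 hx
  have jP := ii_of ht (int_tx (PP w f) t R (PP_cont hw hf)
    fun τ x h0 h1 hx => PP_v ht hw hv τ x h0 h1 hx)
  have jQ := ii_of ht (int_tx (QQ w) t R (QQ_cont hw) fun τ x h0 h1 hx => QQ_v hv τ x h0 h1 hx)
  have jG := fun a => ii_of ht (QG_int_tx ht hw hv a)
  have jS : IntervalIntegrable (fun τ => ∑ a, ∫ x, QG w a (τ, x)) volume 0 t := by
    have := IntervalIntegrable.sum Finset.univ (fun a _ => jG a)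
    simpa [Finset.sum_fn] using this
  have hsw := swap ht jH
  have hl : ∫ τ in (0:ℝ)..t, ∫ x, HH w (τ, x) = ∫ τ in (0:ℝ)..t,
      ((∫ x, PP w f (τ, x)) - (∫ x, QQ w (τ, x)) - ∑ a, ∫ x, QG w a (τ, x)) := by
    refine intervalIntegral.integral_congr fun τ hτ => ?_
    rw [Set.uIcc_of_le ht] at hτ
    exact slice ht hR hw hv hf τ hτ.1 hτ.2
  rw [intervalIntegral.integral_sub (jP.sub jQ) jS, intervalIntegral.integral_sub jP jQ,
    intervalIntegral.integral_finsetSum fun a _ => jG a] at hl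
  have hr : ∀ x, ∫ τ in (0:ℝ)..t, HH w (τ, x) =
      wt (t, x) * en w (t, x) - wt (0, x) * en w (0, x) := fun x =>
    intervalIntegral.integral_eq_sub_of_hasDerivAt (fun τ _ => en_dt hw τ x)
      (((HH_cont hw).comp (by fun_prop : Continuous fun s : ℝ => (s, x))).intervalIntegrable _ _)
  simp only [hr] at hsw
  have ie : ∀ τ, 0 ≤ τ → τ ≤ t → Integrable fun x => wt (τ, x) * en w (τ, x) := fun τ h0 h1 =>
    int_x _ R ((wt_cont.mul (en_cont hw)).comp (by fun_prop : Continuous fun x : Sp => (τ, x)))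
      fun x hx => by simp [en_v ht hw hv τ x h0 h1 hx]
  rw [integral_sub (ie t ht le_rfl) (ie 0 le_rfl ht)] at hsw
  linarith

lemma en_nonneg (w : Pt → ℝ) (z) : 0 ≤ en w z := by unfold en; positivity

lemma final (ht : 0 ≤ t) (hR : 0 ≤ R) (hw : Sm w) (hv : Van (t+1) R w) (hf : ∀ p : Pt, box w p + w p = f p) : Egst w t ≤ (2 * (1 + 2 * M)) * (KGen w 0 +
          ∫ τ in (0:ℝ)..t, ∫ x : Sp, |f (pt τ x) * pd 0 w (pt τ x)|) := by
  have hm := main ht hR hw hv hf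
  have hM := M_nonneg
  have ic : ∀ τ, 0 ≤ τ → τ ≤ t → Integrable fun x => en w (τ, x) := fun τ h0 h1 =>
    int_x _ R ((en_cont hw).comp (by fun_prop : Continuous fun x : Sp => (τ, x)))
      fun x hx => en_v ht hw hv τ x h0 h1 hx
  have ie : ∀ τ, 0 ≤ τ → τ ≤ t → Integrable fun x => wt (τ, x) * en w (τ, x) := fun τ h0 h1 =>
    int_x _ R ((wt_cont.mul (en_cont hw)).comp (by fun_prop : Continuous fun x : Sp => (τ, x)))
      fun x hx => by simp [en_v ht hw hv τ x h0 h1 hx]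
  have k1 : KGen w t ≤ ∫ x, wt (t, x) * en w (t, x) := by
    refine integral_mono (ic t ht le_rfl) (ie t ht le_rfl) fun x => ?_
    exact le_mul_of_one_le_left (en_nonneg w (t, x)) (W_ge _)
  have k2 : (∫ x, wt (0, x) * en w (0, x)) ≤ (1 + 2 * M) * KGen w 0 := by
    have : (1 + 2 * M) * KGen w 0 = ∫ x, (1 + 2 * M) * en w (0, x) := by
      rw [integral_const_mul]; rfl
    rw [this]
    refine integral_mono (ie 0 le_rfl ht) ((ic 0 le_rfl ht).const_mul _) fun x => ?_
    exact mul_le_mul_of_nonneg_right (W_le _) (en_nonneg w _)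
  have k0 : 0 ≤ KGen w 0 := integral_nonneg fun x => en_nonneg w (0, x)
  have cA : Continuous fun z : ℝ × Sp => |f (pt z.1 z.2) * pd 0 w (pt z.1 z.2)| :=
    ((f_sm hw hf).cont.mul (hw.pd 0).cont).abs
  have vA : ∀ τ x, 0 ≤ τ → τ ≤ t → R < rnorm x → |f (pt τ x) * pd 0 w (pt τ x)| = 0 :=
    fun τ x h0 h1 hx => by simp [v1 ht hw hv _ τ x h0 h1 hx]
  have k3 : (∫ τ in (0:ℝ)..t, ∫ x, PP w f (τ, x)) ≤
      (2 * (1 + 2 * M)) * ∫ τ in (0:ℝ)..t, ∫ x : Sp, |f (pt τ x) * pd 0 w (pt τ x)| := by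
    rw [← intervalIntegral.integral_const_mul]
    refine intervalIntegral.integral_mono_on ht (ii_of ht (int_tx (PP w f) t R (PP_cont hw hf)
      fun τ x h0 h1 hx => PP_v ht hw hv τ x h0 h1 hx))
      ((ii_of ht (int_tx _ t R cA vA)).const_mul _) fun τ hτ => ?_
    rw [← integral_const_mul]
    have cp : Continuous fun x : Sp => (τ, x) := by fun_prop
    refine integral_mono (int_x (fun x => PP w f (τ, x)) R ((PP_cont hw hf).comp cp)
      fun x hx => PP_v ht hw hv τ x hτ.1 hτ.2 hx)
      ((int_x _ R (cA.comp cp) fun x hx => vA τ x hτ.1 hτ.2 hx).const_mul _) fun x => ?_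
    simp only [PP, mul_assoc]
    refine mul_le_mul_of_nonneg_left ?_ (by norm_num)
    have hg := W_ge (rnorm x - τ)
    calc wt (τ, x) * (f (pt τ x) * pd 0 w (pt τ x))
        ≤ wt (τ, x) * |f (pt τ x) * pd 0 w (pt τ x)| :=
          mul_le_mul_of_nonneg_left (le_abs_self _) (zero_le_one.trans hg)
      _ ≤ _ := mul_le_mul_of_nonneg_right (W_le _) (abs_nonneg _)
  have hE : Egst w t = KGen w t + (∫ τ in (0:ℝ)..t, ∫ x, QQ w (τ, x)) +
    (∑ a, ∫ τ in (0:ℝ)..t, ∫ x, QG w a (τ, x)) := rfl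
  rw [hE]
  nlinarith [mul_nonneg (by linarith : (0:ℝ) ≤ 1 + 2 * M) k0]

end

end Ghost

/-- ghost weight estimate for the 3D Klein–Gordon equation. -/
theorem stmt_18 :
    ∃ C : ℝ, 0 < C ∧ ∀ w f : Pt → ℝ, ContDiff ℝ (⊤ : ℕ∞) w →
      (∀ T : ℝ, ∃ R : ℝ, ∀ (t : ℝ) (x : Sp), 0 ≤ t → t ≤ T → R ≤ rnorm x → w (pt t x) = 0) →
      (∀ p : Pt, box w p + w p = f p) →
      ∀ (t : ℝ), 0 ≤ t →
        Egst w t ≤ C * (KGen w 0 +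
          ∫ τ in (0:ℝ)..t, ∫ x : Sp, |f (pt τ x) * pd 0 w (pt τ x)|) := by
  refine ⟨2 * (1 + 2 * Ghost.M), by linarith [Ghost.M_nonneg], ?_⟩
  intro w f hw hs hf t ht
  obtain ⟨R, hR⟩ := hs (t + 1)
  refine Ghost.final (R := max R 0) ht (le_max_right _ _) hw ?_ hf
  intro s x h0 h1 hx
  exact hR s x h0 h1 ((le_max_left _ _).trans hx.le)
end
end
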